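/- arXiv:2004.05393 — 4 statements merged into one kernel-verified Lean document; each statement's English description precedes it below -/
import Mathlib

section
/- Let K = ℚ(ξ) where ξ is a root of the irreducible polynomial f₁₂(x) = x¹² + 8x⁸ + 15x⁴ + 7. Then the discriminant of the number field K equals 2²⁴ · 7³ · 19⁸. -/
open NumberField

section DedekindCriterion

open Polynomial

variable {K : Type*} [Field K] {ξ : K} {f : ℤ[X]} {p : ℕ} [Fact p.Prime]

/-- A polynomial over `ℤ` divisible modulo `p` by (the reduction of) `g` is, up to a multiple of
`p`, a multiple of `g`. -/
theorem Polynomial.exists_eq_mul_add_of_map_dvd_map {g P : ℤ[X]}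
    (h : g.map (Int.castRingHom (ZMod p)) ∣ P.map (Int.castRingHom (ZMod p))) :
    ∃ a Q : ℤ[X], P = g * a + (p : ℤ[X]) * Q := by
  obtain ⟨b, hb⟩ := h
  obtain ⟨a, rfl⟩ := map_surjective _ (ZMod.ringHom_surjective (Int.castRingHom (ZMod p))) b
  have h0 : (P - g * a).map (Int.castRingHom (ZMod p)) = 0 := by simp [hb]
  obtain ⟨Q, hQ⟩ : (C (p : ℤ)) ∣ P - g * a := by
    rw [C_dvd_iff_dvd_coeff]
    intro i
    rw [← ZMod.intCast_zmod_eq_zero_iff_dvd]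
    simpa only [coeff_map, coeff_zero, eq_intCast] using congrArg (fun q => q.coeff i) h0
  refine ⟨a, Q, ?_⟩
  rw [map_natCast] at hQ
  linear_combination hQ

/-- If `β` is integral and `p β = P(ξ)`, then `P` modulo `p` is divisible by every squarefree
divisor of `f` modulo `p`. -/
theorem map_dvd_map_of_isIntegral (hker : ∀ P : ℤ[X], aeval ξ P = 0 → f ∣ P)
    {s : (ZMod p)[X]} (hs : Squarefree s) (hsf : s ∣ f.map (Int.castRingHom (ZMod p)))
    {β : K} (hβ : IsIntegral ℤ β) {P : ℤ[X]} (hP : (p : K) * β = aeval ξ P) :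
    s ∣ P.map (Int.castRingHom (ZMod p)) := by
  obtain ⟨m, hm, hm0⟩ := hβ
  set n := m.natDegree with hn
  have hsum : β ^ n + ∑ i ∈ Finset.range n, (m.coeff i : K) * β ^ i = 0 := by
    have h := hm0
    rw [eval₂_eq_sum_range, Finset.sum_range_succ, ← hn, hm.coeff_natDegree] at h
    simp only [eq_intCast, Int.cast_one, one_mul] at h
    linear_combination h
  set R : ℤ[X] := ∑ i ∈ Finset.range n, C (m.coeff i) * (p : ℤ[X]) ^ (n - 1 - i) * P ^ i with hR
  have hzero : aeval ξ (P ^ n + (p : ℤ[X]) * R) = 0 := by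
    have hpow : ∀ i ∈ Finset.range n, (p : K) * ((m.coeff i : K) * (p : K) ^ (n - 1 - i) *
        ((p : K) * β) ^ i) = (p : K) ^ n * ((m.coeff i : K) * β ^ i) := by
      intro i hi
      have hi' : n = 1 + (n - 1 - i) + i := by have := Finset.mem_range.1 hi; omega
      conv_rhs => rw [hi']
      ring
    simp only [hR, map_add, map_mul, map_pow, map_sum, map_natCast, map_intCast, ← hP,
      eq_intCast, Finset.mul_sum]
    rw [Finset.sum_congr rfl hpow, ← Finset.mul_sum, mul_pow, ← mul_add, hsum, mul_zero]
  have hdvd := hsf.trans (Polynomial.map_dvd (Int.castRingHom (ZMod p)) (hker _ hzero))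
  refine (isRadical_iff_squarefree_of_ne_zero hs.ne_zero).2 hs n _ ?_
  simpa using hdvd

/-- The order `ℤ[ξ]` has index prime to `c` in its integral closure: an integral `α` with
`c α ∈ ℤ[ξ]` lies in `ℤ[ξ]`. -/
def IsMaximalAt (ξ : K) (c : ℕ) : Prop :=
  ∀ α : K, IsIntegral ℤ α → ∀ P : ℤ[X], (c : K) * α = aeval ξ P → ∃ Q : ℤ[X], aeval ξ Q = α

theorem IsMaximalAt.mul {a b : ℕ} (ha : IsMaximalAt ξ a) (hb : IsMaximalAt ξ b) :
    IsMaximalAt ξ (a * b) := by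
  intro α hα P hP
  have hbα : IsIntegral ℤ ((b : K) * α) := (map_natCast (algebraMap ℤ K) b ▸
    isIntegral_algebraMap : IsIntegral ℤ (b : K)).mul hα
  obtain ⟨Q, hQ⟩ := ha _ hbα P (by rw [← hP]; push_cast; ring)
  exact hb α hα Q hQ.symm

theorem IsMaximalAt.pow {a : ℕ} (ha : IsMaximalAt ξ a) (n : ℕ) : IsMaximalAt ξ (a ^ n) := by
  induction n with
  | zero => exact fun α _ P hP => ⟨P, by simpa using hP.symm⟩
  | succ n ih => exact ih.mul ha

/-- **Dedekind's criterion.** Let `f = h ^ (e + 1) * k + p * F`, where modulo `p` the polynomial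
`h * k` is squarefree and `h` is coprime to `k` and to `F`. Then `ℤ[ξ]` is `p`-maximal. -/
theorem isMaximalAt_of_eq_pow_mul_add [CharZero K] (hint : IsIntegral ℤ ξ)
    (hξ : aeval ξ f = 0)
    (hker : ∀ P : ℤ[X], aeval ξ P = 0 → f ∣ P) {e : ℕ} {h k F : ℤ[X]}
    (hf : f = h ^ (e + 1) * k + (p : ℤ[X]) * F)
    (hsq : Squarefree ((h * k).map (Int.castRingHom (ZMod p))))
    (hhk : IsCoprime (h.map (Int.castRingHom (ZMod p))) (k.map (Int.castRingHom (ZMod p))))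
    (hhF : IsCoprime (h.map (Int.castRingHom (ZMod p))) (F.map (Int.castRingHom (ZMod p)))) :
    IsMaximalAt ξ p := by
  intro α hα P hP
  have hp0 : (p : K) ≠ 0 := Nat.cast_ne_zero.2 (Fact.out : p.Prime).ne_zero
  have hfmap : f.map (Int.castRingHom (ZMod p)) =
      (h ^ (e + 1) * k).map (Int.castRingHom (ZMod p)) := by simp [hf]
  have hsf : (h * k).map (Int.castRingHom (ZMod p)) ∣ f.map (Int.castRingHom (ZMod p)) := by
    rw [hfmap]
    exact Polynomial.map_dvd _ (mul_dvd_mul_right (dvd_pow_self h e.succ_ne_zero) k)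
  have haeval (Q : ℤ[X]) : IsIntegral ℤ (aeval ξ Q) :=
    adjoin_le_integralClosure hint (aeval_mem_adjoin_singleton ℤ ξ)
  have key : ∀ i ≤ e, (h ^ (i + 1) * k).map (Int.castRingHom (ZMod p)) ∣
      P.map (Int.castRingHom (ZMod p)) := by
    intro i
    induction i with
    | zero =>
      intro _
      simpa using map_dvd_map_of_isIntegral hker hsq hsf hα hP
    | succ i ih =>
      intro hi
      obtain ⟨a, Q, hPQ⟩ := exists_eq_mul_add_of_map_dvd_map (ih (by omega))
      set γ := (α - aeval ξ Q) * aeval ξ h ^ (e - 1 - i) with hγ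
      have hγint : IsIntegral ℤ γ := (hα.sub (haeval Q)).mul ((haeval h).pow _)
      have hpγ : (p : K) * γ = aeval ξ h ^ e * aeval ξ k * aeval ξ a := by
        have he : e = i + 1 + (e - 1 - i) := by omega
        have h1 : (p : K) * (α - aeval ξ Q) = aeval ξ h ^ (i + 1) * aeval ξ k * aeval ξ a := by
          rw [mul_sub, hP, hPQ]
          simp
        conv_rhs => rw [he]
        rw [hγ, ← mul_assoc, h1]
        ring
      clear_value γ
      have hrel : aeval ξ h ^ (e + 1) * aeval ξ k = (p : K) * -aeval ξ F := by
        have := hξ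
        rw [hf] at this
        simp only [map_add, map_mul, map_pow, map_natCast] at this
        linear_combination this
      have hpγ' : (p : K) * γ ^ (e + 1) = aeval ξ ((-F) ^ e * (k * a ^ (e + 1))) := by
        refine mul_left_cancel₀ (pow_ne_zero e hp0) ?_
        calc (p : K) ^ e * (p * γ ^ (e + 1)) = (p * γ) ^ (e + 1) := by ring
          _ = (aeval ξ h ^ (e + 1) * aeval ξ k) ^ e * (aeval ξ k * aeval ξ a ^ (e + 1)) := by
            rw [hpγ]; ring
          _ = _ := by
            rw [hrel, mul_pow]
            simp only [map_mul, map_pow, map_neg]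
            ring
      have hdvd := map_dvd_map_of_isIntegral hker hsq hsf (hγint.pow (e + 1)) hpγ'
      have hha : h.map (Int.castRingHom (ZMod p)) ∣ a.map (Int.castRingHom (ZMod p)) := by
        have hhsq : Squarefree (h.map (Int.castRingHom (ZMod p))) :=
          hsq.squarefree_of_dvd (Polynomial.map_dvd _ (dvd_mul_right h k))
        have h2 := (Polynomial.map_dvd (Int.castRingHom (ZMod p)) (dvd_mul_right h k)).trans hdvd
        simp only [Polynomial.map_mul, Polynomial.map_pow, Polynomial.map_neg] at h2
        have h3 := hhk.dvd_of_dvd_mul_left (hhF.neg_right.pow_right.dvd_of_dvd_mul_left h2)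
        exact (isRadical_iff_squarefree_of_ne_zero hhsq.ne_zero).2 hhsq _ _ h3
      rw [hPQ]
      obtain ⟨c, hc⟩ := hha
      refine ⟨c, ?_⟩
      simp only [Polynomial.map_add, Polynomial.map_mul, Polynomial.map_pow, Polynomial.map_natCast,
        CharP.cast_eq_zero, zero_mul, add_zero, hc]
      ring
  obtain ⟨a, Q, hPQ⟩ := exists_eq_mul_add_of_map_dvd_map (g := f) (hfmap ▸ key e le_rfl)
  refine ⟨Q, mul_left_cancel₀ hp0 ?_⟩
  rw [hP, hPQ]
  simp [hξ]

end DedekindCriterion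

section Discriminant

open Polynomial

variable {K : Type*} [Field K] [NumberField K]

/-- If the ring of integers is `ℤ[ξ]`, the field discriminant is that of the power basis of `ξ`. -/
theorem NumberField.discr_eq_discr_powerBasis (B : PowerBasis ℚ K) (hint : IsIntegral ℤ B.gen)
    (hmax : ∀ α : K, IsIntegral ℤ α → ∃ Q : ℤ[X], aeval B.gen Q = α) :
    (NumberField.discr K : ℚ) = Algebra.discr ℚ B.basis := by
  classical
  rw [NumberField.coe_discr]
  refine Algebra.discr_eq_discr_of_toMatrix_coeff_isIntegral K (fun i j => ?_) (fun i j => ?_)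
  · have hj : IsIntegral ℤ (B.basis j) := by
      rw [B.basis_eq_pow]
      exact hint.pow _
    rw [Module.Basis.toMatrix_apply]
    have := NumberField.integralBasis_repr_apply K ⟨B.basis j, hj⟩ i
    rw [show B.basis j = algebraMap (𝓞 K) K ⟨B.basis j, hj⟩ from rfl, this]
    exact isIntegral_algebraMap
  · rw [Module.Basis.toMatrix_apply]
    obtain ⟨Q, hQ⟩ := hmax (NumberField.integralBasis K j) (by
      rw [NumberField.integralBasis_apply]
      exact RingOfIntegers.isIntegral_coe _)
    rw [← hQ, aeval_eq_sum_range, map_sum, Finsupp.finsetSum_apply]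
    refine IsIntegral.sum _ fun n _ => ?_
    rw [← Int.cast_smul_eq_zsmul ℚ, map_smul, Finsupp.smul_apply, Int.cast_smul_eq_zsmul]
    exact (PowerBasis.repr_gen_pow_isIntegral hint
      (minpoly.isIntegrallyClosed_eq_field_fractions' ℚ hint) n i).smul _

/-- The norm to `ℚ` of an element of a subfield of even codegree is nonnegative. -/
theorem norm_nonneg_of_even_finrank {F : IntermediateField ℚ K}
    (heven : Even (Module.finrank F K)) {x : K} (hx : x ∈ F) : 0 ≤ Algebra.norm ℚ x := by
  have h := Algebra.norm_norm (R := ℚ) (S := F) (a := x)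
  rw [show x = algebraMap F K ⟨x, hx⟩ from rfl, Algebra.norm_algebraMap, map_pow] at h
  rw [show x = algebraMap F K ⟨x, hx⟩ from rfl, ← h]
  exact heven.pow_nonneg _

/-- The norm of a unit of the ring of integers has absolute value one. -/
theorem abs_norm_eq_one_of_mul_eq_one {u v : K} (hu : IsIntegral ℤ u) (hv : IsIntegral ℤ v)
    (huv : u * v = 1) : |Algebra.norm ℚ u| = 1 := by
  obtain ⟨a, ha⟩ := IsIntegrallyClosed.isIntegral_iff.1 (Algebra.isIntegral_norm ℚ hu)
  obtain ⟨b, hb⟩ := IsIntegrallyClosed.isIntegral_iff.1 (Algebra.isIntegral_norm ℚ hv)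
  have hab : a * b = 1 := by
    have h : Algebra.norm ℚ u * Algebra.norm ℚ v = 1 := by rw [← map_mul, huv, map_one]
    rw [← ha, ← hb, ← map_mul, eq_intCast] at h
    exact_mod_cast h
  have := Int.isUnit_iff_abs_eq.1 (IsUnit.of_mul_eq_one b hab)
  rw [← ha, eq_intCast]
  exact_mod_cast this

end Discriminant

section Field

open Polynomial

/-- The polynomial `f₁₂ = X¹² + 8X⁸ + 15X⁴ + 7` over the integers. -/
noncomputable def f12 : ℤ[X] := X ^ 12 + 8 * X ^ 8 + 15 * X ^ 4 + 7

theorem f12_monic : f12.Monic := by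
  unfold f12; monicity!

theorem f12_natDegree : f12.natDegree = 12 := by
  unfold f12; compute_degree!

theorem f12_coeff_zero : f12.coeff 0 = 7 := by
  unfold f12; simp

variable {K : Type*} [Field K] [NumberField K] {ξ : K}

theorem f12_decomposition_two :
    f12 = (X ^ 3 + X + 1) ^ (3 + 1) * 1 + ((2 : ℕ) : ℤ[X]) *
      (3 - 2 * X - 3 * X ^ 2 - 4 * X ^ 3 + X ^ 4 - 6 * X ^ 5 - 5 * X ^ 6 - 6 * X ^ 7 + X ^ 8
        - 2 * X ^ 9 - 2 * X ^ 10) := by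
  unfold f12; push_cast; ring

theorem f12_decomposition_seven :
    f12 = X ^ (3 + 1) * (X ^ 8 + 8 * X ^ 4 + 15) + ((7 : ℕ) : ℤ[X]) * 1 := by
  unfold f12; push_cast; ring

theorem f12_decomposition_nineteen :
    f12 = (X ^ 4 + 9) ^ (2 + 1) * 1 + ((19 : ℕ) : ℤ[X]) * (-38 - 12 * X ^ 4 - X ^ 8) := by
  unfold f12; push_cast; ring

theorem f12_isMaximalAt_two (hint : IsIntegral ℤ ξ) (hξ : aeval ξ f12 = 0)
    (hker : ∀ P : ℤ[X], aeval ξ P = 0 → f12 ∣ P) : IsMaximalAt ξ 2 := by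
  have : Fact (Nat.Prime 2) := ⟨Nat.prime_two⟩
  have h2 : (2 : (ZMod 2)[X]) = 0 := CharP.cast_eq_zero (ZMod 2)[X] 2
  refine isMaximalAt_of_eq_pow_mul_add hint hξ hker f12_decomposition_two ?_ ?_ ?_
  · refine Separable.squarefree ⟨1, X, ?_⟩
    simp [C_ofNat]
    linear_combination (X + 2 * X ^ 3) * h2
  · simpa using isCoprime_one_right
  · refine ⟨X + X ^ 2 + X ^ 4 + X ^ 5 + X ^ 6 + X ^ 7, 1 + X + X ^ 2, ?_⟩
    simp
    linear_combination (1 + X - 4 * X ^ 3 - 2 * X ^ 4 - 3 * X ^ 5 - 4 * X ^ 6 - 7 * X ^ 7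
      - 4 * X ^ 8 - 3 * X ^ 9 - X ^ 10 - 2 * X ^ 11 - X ^ 12) * h2

theorem f12_isMaximalAt_seven (hint : IsIntegral ℤ ξ) (hξ : aeval ξ f12 = 0)
    (hker : ∀ P : ℤ[X], aeval ξ P = 0 → f12 ∣ P) : IsMaximalAt ξ 7 := by
  have : Fact (Nat.Prime 7) := ⟨by norm_num⟩
  have h7 : (7 : (ZMod 7)[X]) = 0 := CharP.cast_eq_zero (ZMod 7)[X] 7
  refine isMaximalAt_of_eq_pow_mul_add hint hξ hker f12_decomposition_seven ?_ ?_ ?_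
  · refine Separable.squarefree ⟨2 * X ^ 3 + 6 * X ^ 7, 1 + 4 * X ^ 8, ?_⟩
    simp [C_ofNat]
    linear_combination (2 + 10 * X ^ 4 + 25 * X ^ 8 + 30 * X ^ 12 + 6 * X ^ 16) * h7
  · refine ⟨6 * X ^ 3 + 6 * X ^ 7, 1, ?_⟩
    simp
    linear_combination (2 + 2 * X ^ 4 + X ^ 8) * h7
  · simpa using isCoprime_one_right

theorem f12_isMaximalAt_nineteen (hint : IsIntegral ℤ ξ) (hξ : aeval ξ f12 = 0)
    (hker : ∀ P : ℤ[X], aeval ξ P = 0 → f12 ∣ P) : IsMaximalAt ξ 19 := by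
  have : Fact (Nat.Prime 19) := ⟨by norm_num⟩
  have h19 : (19 : (ZMod 19)[X]) = 0 := CharP.cast_eq_zero (ZMod 19)[X] 19
  refine isMaximalAt_of_eq_pow_mul_add hint hξ hker f12_decomposition_nineteen ?_ ?_ ?_
  · refine Separable.squarefree ⟨17, 10 * X, ?_⟩
    simp [C_ofNat]
    linear_combination (8 + 3 * X ^ 4) * h19
  · simpa using isCoprime_one_right
  · refine ⟨17 + 12 * X ^ 4, 12, ?_⟩
    simp
    linear_combination (-16 - X ^ 4) * h19

theorem Polynomial.aeval_ofNat {R A : Type*} [CommSemiring R] [Semiring A] [Algebra R A] (x : A)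
    (n : ℕ) [n.AtLeastTwo] : aeval x (ofNat(n) : R[X]) = ofNat(n) :=
  map_ofNat (aeval x) n

/-- The norm of `z = 3ξ⁸ + 16ξ⁴ + 15`, that is, of `g'(ξ⁴)` where `f₁₂ = g(X⁴)`. It is a
nonnegative integer whose cube is `19²⁴`, as `z³` is `19²` times a unit. -/
theorem norm_derivative_factor (hint : IsIntegral ℤ ξ) (hfin : Module.finrank ℚ K = 12)
    (hroot : ξ ^ 12 + 8 * ξ ^ 8 + 15 * ξ ^ 4 + 7 = 0) :
    Algebra.norm ℚ (3 * ξ ^ 8 + 16 * ξ ^ 4 + 15) = 19 ^ 8 := by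
  set y := ξ ^ 4 with hy
  have hyroot : y ^ 3 + 8 * y ^ 2 + 15 * y + 7 = 0 := by rw [hy]; linear_combination hroot
  rw [show 3 * ξ ^ 8 + 16 * y + 15 = 3 * y ^ 2 + 16 * y + 15 by rw [hy]; ring]
  have hyint : y ∈ integralClosure ℤ K := hint.pow 4
  have hu : IsIntegral ℤ (y ^ 2 + 3 * y + 2) :=
    add_mem (add_mem (pow_mem hyint 2) (mul_mem (ofNat_mem _ 3) hyint)) (ofNat_mem _ 2)
  have hv : IsIntegral ℤ (2 * y ^ 2 + 13 * y + 11) :=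
    add_mem (add_mem (mul_mem (ofNat_mem _ 2) (pow_mem hyint 2))
      (mul_mem (ofNat_mem _ 13) hyint)) (ofNat_mem _ 11)
  have huv : (y ^ 2 + 3 * y + 2) * (2 * y ^ 2 + 13 * y + 11) = 1 := by
    linear_combination (2 * y + 3) * hyroot
  have hcube : (3 * y ^ 2 + 16 * y + 15) ^ 3 = ((361 : ℕ) : K) * (y ^ 2 + 3 * y + 2) := by
    push_cast
    linear_combination (27 * y ^ 3 + 216 * y ^ 2 + 576 * y + 379) * hyroot
  have hnonneg : 0 ≤ Algebra.norm ℚ (3 * y ^ 2 + 16 * y + 15) := by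
    have hyF := IntermediateField.mem_adjoin_simple_self ℚ y
    refine norm_nonneg_of_even_finrank (F := IntermediateField.adjoin ℚ {y}) ?_ ?_
    · have hmul := Module.finrank_mul_finrank ℚ (IntermediateField.adjoin ℚ {y}) K
      have hle : Module.finrank ℚ (IntermediateField.adjoin ℚ {y}) ≤ 3 := by
        rw [IntermediateField.adjoin.finrank (Algebra.IsIntegral.isIntegral y)]
        have hg : (X ^ 3 + 8 * X ^ 2 + 15 * X + 7 : ℚ[X]).natDegree = 3 := by compute_degree!
        rw [← hg]
        refine natDegree_le_of_dvd (minpoly.dvd ℚ y (by simpa [aeval_ofNat] using hyroot)) ?_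
        intro h
        simp [h] at hg
      rw [hfin] at hmul
      generalize Module.finrank ℚ (IntermediateField.adjoin ℚ {y}) = a at hmul hle
      interval_cases a
      · omega
      all_goals
        rw [Nat.even_iff]
        omega
    · exact add_mem (add_mem (mul_mem (ofNat_mem _ 3) (pow_mem hyF 2))
        (mul_mem (ofNat_mem _ 16) hyF)) (ofNat_mem _ 15)
  have habs := congrArg abs (congrArg (Algebra.norm ℚ) hcube)
  rw [map_mul, abs_mul, abs_norm_eq_one_of_mul_eq_one hu hv huv, Algebra.norm_natCast, hfin,
    map_pow, abs_of_nonneg (pow_nonneg hnonneg 3)] at habs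
  refine (pow_left_inj₀ hnonneg (by norm_num) three_ne_zero).1 ?_
  rw [habs]
  norm_num

end Field

/-- Let `K = ℚ(ξ)` where `ξ` is a root of the irreducible polynomial
`f₁₂(x) = x¹² + 8x⁸ + 15x⁴ + 7`.  Then the discriminant of `K` is `2²⁴ · 7³ · 19⁸`. -/
theorem discr_of_f12_field
    (K : Type*) [Field K] [NumberField K] (ξ : K)
    (hroot : ξ ^ 12 + 8 * ξ ^ 8 + 15 * ξ ^ 4 + 7 = 0)
    (hgen : Algebra.adjoin ℚ {ξ} = ⊤)
    (hirr : Irreducible (Polynomial.X ^ 12 + 8 * Polynomial.X ^ 8 + 15 * Polynomial.X ^ 4 + 7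
      : Polynomial ℚ)) :
    NumberField.discr K = 2 ^ 24 * 7 ^ 3 * 19 ^ 8 := by
  open Polynomial in
  have hξ : aeval ξ f12 = 0 := by simpa [f12, aeval_ofNat] using hroot
  have hint : IsIntegral ℤ ξ := ⟨f12, f12_monic, hξ⟩
  have hf12 : f12.map (algebraMap ℤ ℚ) = X ^ 12 + 8 * X ^ 8 + 15 * X ^ 4 + 7 := by simp [f12]
  have hmin : f12.map (algebraMap ℤ ℚ) = minpoly ℚ ξ :=
    minpoly.eq_of_irreducible_of_monic (hf12 ▸ hirr) (by rwa [aeval_map_algebraMap]) (f12_monic.map _)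
  have hminℤ : f12 = minpoly ℤ ξ := by
    rw [minpoly.isIntegrallyClosed_eq_field_fractions' ℚ hint] at hmin
    exact map_injective _ (algebraMap ℤ ℚ).injective_int hmin
  have hker (P : ℤ[X]) (hP : aeval ξ P = 0) : f12 ∣ P :=
    hminℤ ▸ minpoly.isIntegrallyClosed_dvd hint hP
  let B := PowerBasis.ofAdjoinEqTop (Algebra.IsIntegral.isIntegral (R := ℚ) ξ) hgen
  have hBgen : B.gen = ξ := rfl
  have hBdim : B.dim = 12 := by
    rw [← B.natDegree_minpoly, hBgen, ← hmin, f12_monic.natDegree_map, f12_natDegree]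
  have hfin : Module.finrank ℚ K = 12 := B.finrank.trans hBdim
  have hnormξ : Algebra.norm ℚ ξ = 7 := by
    rw [← hBgen, Algebra.PowerBasis.norm_gen_eq_coeff_zero_minpoly, hBgen, hBdim, ← hmin,
      coeff_map, f12_coeff_zero]
    norm_num
  have hdiscr : Algebra.discr ℚ B.basis = 2 ^ 24 * 7 ^ 3 * 19 ^ 8 := by
    have hder : aeval ξ (minpoly ℚ ξ).derivative =
        ((4 : ℕ) : K) * ξ ^ 3 * (3 * ξ ^ 8 + 16 * ξ ^ 4 + 15) := by
      rw [← hmin, hf12]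
      simp [aeval_ofNat, C_ofNat]
      ring
    rw [Algebra.discr_powerBasis_eq_norm, hBgen, hder, map_mul, map_mul, map_pow,
      norm_derivative_factor hint hfin hroot, hnormξ, Algebra.norm_natCast, hfin]
    norm_num
  have hmax := (((f12_isMaximalAt_two hint hξ hker).pow 24).mul
    ((f12_isMaximalAt_seven hint hξ hker).pow 3)).mul
    ((f12_isMaximalAt_nineteen hint hξ hker).pow 8)
  have hdiscrK := NumberField.discr_eq_discr_powerBasis B hint fun α hα => by
    have hmem := Algebra.discr_mul_isIntegral_mem_adjoin ℚ (B := B) hint hα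
    rw [Algebra.adjoin_singleton_eq_range_aeval, hdiscr] at hmem
    obtain ⟨P, hP⟩ := hmem
    refine hmax α hα P (Eq.trans ?_ hP.symm)
    rw [Algebra.smul_def]
    simp only [map_mul, map_pow, map_ofNat, Nat.cast_mul, Nat.cast_pow, Nat.cast_ofNat]
  rw [hdiscr] at hdiscrK
  exact_mod_cast hdiscrK
end

section
/- Let M = ℚ(μ) where μ is a root of the irreducible polynomial g₃(x) = x³ − 8x² + 15x − 7, with ring of integers O_M. If U, V ∈ O_M are such that U·(U² − 4μV²) is a unit of O_M, then V = 0 and U is a unit of O_M. -/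
open NumberField

namespace CubicResolvent

section PowerBasis

variable {M : Type*} [Field M] [NumberField M] {m : M}

/-- A generator of a cubic field gives the basis `1, m, m²`. -/
theorem exists_powerBasis (hgen : Algebra.adjoin ℚ {m} = ⊤) (hdeg : Module.finrank ℚ M = 3) :
    ∃ B : PowerBasis ℚ M, B.gen = m ∧ B.dim = 3 := by
  have hint : IsIntegral ℚ m := Algebra.IsIntegral.isIntegral m
  refine ⟨PowerBasis.ofAdjoinEqTop hint hgen, rfl, ?_⟩
  rw [← PowerBasis.finrank, hdeg]

theorem leftMulMatrix_eq (b : Module.Basis (Fin 3) ℚ M) (hb : ∀ i, b i = m ^ (i : ℕ))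
    (hroot : m ^ 3 - 8 * m ^ 2 + 15 * m - 7 = 0) :
    Algebra.leftMulMatrix b m = !![0, 0, 7; 1, 0, -15; 0, 1, 8] := by
  have h0 : m * b 0 = b 1 := by simp [hb]
  have h1 : m * b 1 = b 2 := by simp [hb]; ring
  have h2 : m * b 2 = (7 : ℚ) • b 0 + (-15 : ℚ) • b 1 + (8 : ℚ) • b 2 := by
    simp [hb, Algebra.smul_def]; linear_combination hroot
  ext i j
  rw [Algebra.leftMulMatrix_eq_repr_mul]
  fin_cases j
  · fin_cases i <;> simp [h0]
  · fin_cases i <;> simp [h1]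
  · fin_cases i <;> simp [h2]

theorem discr_eq (b : Module.Basis (Fin 3) ℚ M) (hb : ∀ i, b i = m ^ (i : ℕ))
    (hroot : m ^ 3 - 8 * m ^ 2 + 15 * m - 7 = 0) :
    Algebra.discr ℚ b = 361 := by
  have ht (k : ℕ) : Algebra.trace ℚ M (m ^ k) =
      ((!![0, 0, 7; 1, 0, -15; 0, 1, 8] : Matrix (Fin 3) (Fin 3) ℚ) ^ k).trace := by
    rw [Algebra.trace_eq_matrix_trace b, map_pow, leftMulMatrix_eq b hb hroot]
  have hmat : Algebra.traceMatrix ℚ b = !![3, 8, 34; 8, 34, 173; 34, 173, 930] := by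
    ext i j
    rw [Algebra.traceMatrix_apply, Algebra.traceForm_apply, hb, hb, ← pow_add, ht]
    fin_cases i <;> fin_cases j <;>
      simp [pow_succ, Matrix.trace_fin_three] <;> norm_num
  rw [Algebra.discr_def, hmat, Matrix.det_fin_three]
  simp
  norm_num

end PowerBasis

theorem coe_root {M : Type*} [Field M] {μ : 𝓞 M}
    (hroot : μ ^ 3 - 8 * μ ^ 2 + 15 * μ - 7 = 0) :
    (μ : M) ^ 3 - 8 * (μ : M) ^ 2 + 15 * (μ : M) - 7 = 0 := by
  have h := congrArg (algebraMap (𝓞 M) M) hroot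
  rwa [map_sub, map_add, map_sub, map_mul, map_mul, map_pow, map_pow, map_ofNat, map_ofNat,
    map_ofNat, map_zero] at h

variable {M : Type*} [Field M] [NumberField M] {μ : 𝓞 M}

theorem exists_int_coords (hroot : μ ^ 3 - 8 * μ ^ 2 + 15 * μ - 7 = 0)
    (hgen : Algebra.adjoin ℚ {algebraMap (𝓞 M) M μ} = ⊤)
    (hdeg : Module.finrank ℚ M = 3) (x : 𝓞 M) :
    ∃ a b c : ℤ, 361 * x = a + b * μ + c * μ ^ 2 := by
  obtain ⟨B, hB, hdim⟩ := exists_powerBasis hgen hdeg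
  have hrootM := coe_root hroot
  have hd : Algebra.discr ℚ B.basis = 361 := by
    rw [← Algebra.discr_reindex ℚ B.basis (finCongr hdim)]
    have := discr_eq (m := (μ : M)) (B.basis.reindex (finCongr hdim))
      (fun i => by simp [hB]) hrootM
    rwa [Module.Basis.coe_reindex] at this
  have key := Algebra.discr_mul_isIntegral_mem_adjoin (R := ℤ) ℚ (B := B)
    (hB ▸ μ.isIntegral_coe) x.isIntegral_coe
  rw [hd, hB] at key
  have hmem : ∀ y ∈ Algebra.adjoin ℤ {(μ : M)},
      ∃ a b c : ℤ, y = a + b * (μ : M) + c * (μ : M) ^ 2 := by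
    intro y hy
    induction hy using Algebra.adjoin_induction with
    | mem y hy => exact ⟨0, 1, 0, by simpa using hy⟩
    | algebraMap r => exact ⟨r, 0, 0, by simp⟩
    | add y z _ _ hy hz =>
      obtain ⟨a, b, c, rfl⟩ := hy
      obtain ⟨a', b', c', rfl⟩ := hz
      exact ⟨a + a', b + b', c + c', by push_cast; ring⟩
    | mul y z _ _ hy hz =>
      obtain ⟨a, b, c, rfl⟩ := hy
      obtain ⟨a', b', c', rfl⟩ := hz
      refine ⟨a * a' + 7 * (b * c' + c * b') + 56 * (c * c'),
        a * b' + b * a' - 15 * (b * c' + c * b') - 113 * (c * c'),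
        a * c' + b * b' + c * a' + 8 * (b * c' + c * b') + 49 * (c * c'), ?_⟩
      push_cast
      linear_combination ((b * c' + c * b' : M) + c * c' * ((μ : M) + 8)) * hrootM
  obtain ⟨a, b, c, h⟩ := hmem _ key
  refine ⟨a, b, c, RingOfIntegers.ext ?_⟩
  rw [Algebra.smul_def, map_ofNat] at h
  change algebraMap (𝓞 M) M _ = algebraMap (𝓞 M) M _
  rw [map_mul, map_ofNat]
  simpa using h

theorem coords_eq_zero (hgen : Algebra.adjoin ℚ {algebraMap (𝓞 M) M μ} = ⊤)
    (hdeg : Module.finrank ℚ M = 3) {a b c : ℤ} (h : (a + b * μ + c * μ ^ 2 : 𝓞 M) = 0) :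
    a = 0 ∧ b = 0 ∧ c = 0 := by
  obtain ⟨B, hB, hdim⟩ := exists_powerBasis hgen hdeg
  have hli := (B.basis.reindex (finCongr hdim)).linearIndependent
  rw [Fintype.linearIndependent_iff] at hli
  have hM : (a + b * (μ : M) + c * (μ : M) ^ 2 : M) = 0 := by
    simpa using congrArg (algebraMap (𝓞 M) M) h
  have := hli ![a, b, c] (by
    simpa [Fin.sum_univ_three, hB, Algebra.smul_def] using hM)
  exact ⟨by simpa using this 0, by simpa using this 1, by simpa using this 2⟩

theorem four_dvd_coords (hroot : μ ^ 3 - 8 * μ ^ 2 + 15 * μ - 7 = 0)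
    (hgen : Algebra.adjoin ℚ {algebraMap (𝓞 M) M μ} = ⊤)
    (hdeg : Module.finrank ℚ M = 3) {a b c : ℤ} (h : (4 : 𝓞 M) ∣ a + b * μ + c * μ ^ 2) :
    4 ∣ a ∧ 4 ∣ b ∧ 4 ∣ c := by
  obtain ⟨x, hx⟩ := h
  obtain ⟨a', b', c', hx'⟩ := exists_int_coords hroot hgen hdeg x
  have := coords_eq_zero (μ := μ) hgen hdeg
    (a := 361 * a - 4 * a') (b := 361 * b - 4 * b') (c := 361 * c - 4 * c') (by
      push_cast
      linear_combination 361 * hx + 4 * hx')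
  omega

/-- If `(p + qμ + rμ²) η² ≡ 1 mod 4`, the congruence already holds in `ℤ[μ]/4`. -/
theorem exists_coords_zmod (hroot : μ ^ 3 - 8 * μ ^ 2 + 15 * μ - 7 = 0)
    (hgen : Algebra.adjoin ℚ {algebraMap (𝓞 M) M μ} = ⊤)
    (hdeg : Module.finrank ℚ M = 3) (p q r : ℤ) {η : 𝓞 M}
    (h : (4 : 𝓞 M) ∣ (p + q * μ + r * μ ^ 2) * η ^ 2 - 1) :
    ∃ a b c s t u : ZMod 4,
      s = a * a + 7 * (2 * b * c) + 56 * (c * c) ∧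
      t = 2 * a * b - 15 * (2 * b * c) - 113 * (c * c) ∧
      u = 2 * a * c + b * b + 8 * (2 * b * c) + 49 * (c * c) ∧
      p * s + 7 * (q * u + r * t) + 56 * (r * u) - 1 = 0 ∧
      p * t + q * s - 15 * (q * u + r * t) - 113 * (r * u) = 0 ∧
      p * u + q * t + r * s + 8 * (q * u + r * t) + 49 * (r * u) = 0 := by
  obtain ⟨a, b, c, hη⟩ := exists_int_coords hroot hgen hdeg η
  obtain ⟨s, hs⟩ : ∃ s, s = a * a + 7 * (2 * b * c) + 56 * (c * c) := ⟨_, rfl⟩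
  obtain ⟨t, ht⟩ : ∃ t, t = 2 * a * b - 15 * (2 * b * c) - 113 * (c * c) := ⟨_, rfl⟩
  obtain ⟨u, hu⟩ : ∃ u, u = 2 * a * c + b * b + 8 * (2 * b * c) + 49 * (c * c) := ⟨_, rfl⟩
  have hsq : (361 * η) ^ 2 = s + t * μ + u * μ ^ 2 := by
    rw [hη, hs, ht, hu]
    push_cast
    linear_combination (2 * b * c + c * c * (μ + 8)) * hroot
  obtain ⟨x, hx⟩ := h
  have h4 := four_dvd_coords (μ := μ) hroot hgen hdeg
    (a := p * s + 7 * (q * u + r * t) + 56 * (r * u) - 1)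
    (b := p * t + q * s - 15 * (q * u + r * t) - 113 * (r * u))
    (c := p * u + q * t + r * s + 8 * (q * u + r * t) + 49 * (r * u))
    ⟨361 ^ 2 * x + 32580, by
      push_cast
      linear_combination 361 ^ 2 * hx - (p + q * μ + r * μ ^ 2) * hsq
        - (q * u + r * t + r * u * (μ + 8)) * hroot⟩
  have hz (n : ℤ) (hn : 4 ∣ n) : (n : ZMod 4) = 0 :=
    (ZMod.intCast_zmod_eq_zero_iff_dvd n 4).2 (by exact_mod_cast hn)
  exact ⟨a, b, c, s, t, u, by rw [hs]; push_cast; rfl, by rw [ht]; push_cast; rfl,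
    by rw [hu]; push_cast; rfl, by simpa using hz _ h4.1, by simpa using hz _ h4.2.1,
    by simpa using hz _ h4.2.2⟩

theorem eq_zero_of_four_dvd (hroot : μ ^ 3 - 8 * μ ^ 2 + 15 * μ - 7 = 0)
    (hgen : Algebra.adjoin ℚ {algebraMap (𝓞 M) M μ} = ⊤)
    (hdeg : Module.finrank ℚ M = 3) (i j k : Fin 2) {η : 𝓞 M}
    (h : (4 : 𝓞 M) ∣ (-1) ^ (i : ℕ) * (μ - 1) ^ (j : ℕ) * (μ - 2) ^ (k : ℕ) * η ^ 2 - 1) :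
    i = 0 ∧ j = 0 ∧ k = 0 := by
  have key (p q r : ℤ)
      (he : (-1) ^ (i : ℕ) * (μ - 1) ^ (j : ℕ) * (μ - 2) ^ (k : ℕ) = p + q * μ + r * μ ^ 2) :=
    exists_coords_zmod hroot hgen hdeg p q r (he ▸ h)
  fin_cases i <;> fin_cases j <;> fin_cases k
  · simp
  · obtain ⟨a, b, c, s, t, u, rfl, rfl, rfl, h⟩ := key (-2) 1 0 (by push_cast; ring)
    revert a b c; decide
  · obtain ⟨a, b, c, s, t, u, rfl, rfl, rfl, h⟩ := key (-1) 1 0 (by push_cast; ring)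
    revert a b c; decide
  · obtain ⟨a, b, c, s, t, u, rfl, rfl, rfl, h⟩ := key 2 (-3) 1 (by push_cast; ring)
    revert a b c; decide
  · obtain ⟨a, b, c, s, t, u, rfl, rfl, rfl, h⟩ := key (-1) 0 0 (by push_cast; ring)
    revert a b c; decide
  · obtain ⟨a, b, c, s, t, u, rfl, rfl, rfl, h⟩ := key 2 (-1) 0 (by push_cast; ring)
    revert a b c; decide
  · obtain ⟨a, b, c, s, t, u, rfl, rfl, rfl, h⟩ := key 1 (-1) 0 (by push_cast; ring)
    revert a b c; decide
  · obtain ⟨a, b, c, s, t, u, rfl, rfl, rfl, h⟩ := key (-2) 3 (-1) (by push_cast; ring)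
    revert a b c; decide

/-- The unit group of a cubic field has at most eight square classes. -/
theorem card_units_quotient_squares_le (hdeg : Module.finrank ℚ M = 3) :
    Finite ((𝓞 M)ˣ ⧸ (powMonoidHom 2 : (𝓞 M)ˣ →* (𝓞 M)ˣ).range) ∧
      Nat.card ((𝓞 M)ˣ ⧸ (powMonoidHom 2 : (𝓞 M)ˣ →* (𝓞 M)ˣ).range) ≤ 8 := by
  have hrank : Units.rank M ≤ 2 := by
    have h1 := InfinitePlace.card_add_two_mul_card_eq_rank M
    have h2 := InfinitePlace.card_eq_nrRealPlaces_add_nrComplexPlaces M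
    rw [Units.rank]
    omega
  let f : Fin 2 × (Fin (Units.rank M) → Fin 2) →
      (𝓞 M)ˣ ⧸ (powMonoidHom 2 : (𝓞 M)ˣ →* (𝓞 M)ˣ).range :=
    fun x => QuotientGroup.mk ((-1) ^ (x.1 : ℕ) * ∏ i, Units.fundSystem M i ^ (x.2 i : ℕ))
  have hf : Function.Surjective f := by
    intro y
    obtain ⟨x, rfl⟩ := QuotientGroup.mk_surjective y
    obtain ⟨⟨ζ, e⟩, hx, -⟩ := Units.exist_unique_eq_mul_prod M x
    obtain ⟨s, hs⟩ : ∃ s : Fin 2, (ζ : (𝓞 M)ˣ) = (-1) ^ (s : ℕ) := by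
      rcases Units.torsion_eq_one_or_neg_one_of_odd_finrank (hdeg ▸ by decide) ζ with h | h
      · exact ⟨0, by simp [h]⟩
      · exact ⟨1, by simp [h]⟩
    refine ⟨(s, fun i => ⟨(e i % 2).toNat, by omega⟩), ?_⟩
    refine QuotientGroup.eq.2 ⟨∏ i, Units.fundSystem M i ^ (e i / 2), ?_⟩
    rw [eq_inv_mul_iff_mul_eq, hx, hs, powMonoidHom_apply, mul_assoc, ← Finset.prod_pow,
      ← Finset.prod_mul_distrib]
    congr 1
    refine Finset.prod_congr rfl fun i _ => ?_
    rw [← zpow_natCast, ← zpow_natCast, ← zpow_mul, ← zpow_add]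
    congr 1
    simp only [Nat.cast_ofNat]
    omega
  have := Finite.of_surjective f hf
  refine ⟨this, (Nat.card_le_card_of_surjective f hf).trans ?_⟩
  have : 2 ^ Units.rank M ≤ 2 ^ 2 := Nat.pow_le_pow_right (by norm_num) hrank
  simp
  omega

theorem sq_of_four_dvd_sub_one (hroot : μ ^ 3 - 8 * μ ^ 2 + 15 * μ - 7 = 0)
    (hgen : Algebra.adjoin ℚ {algebraMap (𝓞 M) M μ} = ⊤)
    (hdeg : Module.finrank ℚ M = 3) (ε : (𝓞 M)ˣ) (h : (4 : 𝓞 M) ∣ ε - 1) :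
    ∃ η : (𝓞 M)ˣ, ε = η ^ 2 := by
  obtain ⟨e₁, he₁⟩ : IsUnit (μ - 1) :=
    .of_mul_eq_one (-(μ ^ 2 - 7 * μ + 8)) (by linear_combination -hroot)
  obtain ⟨e₂, he₂⟩ : IsUnit (μ - 2) :=
    .of_mul_eq_one (μ ^ 2 - 6 * μ + 3) (by linear_combination hroot)
  let N := (powMonoidHom 2 : (𝓞 M)ˣ →* (𝓞 M)ˣ).range
  let g : Fin 2 × Fin 2 × Fin 2 → (𝓞 M)ˣ :=
    fun x => (-1) ^ (x.1 : ℕ) * e₁ ^ (x.2.1 : ℕ) * e₂ ^ (x.2.2 : ℕ)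
  have hg (x) (η : (𝓞 M)ˣ) (hη : (4 : 𝓞 M) ∣ (g x * η ^ 2 : (𝓞 M)ˣ) - 1) : x = 0 := by
    have := eq_zero_of_four_dvd hroot hgen hdeg x.1 x.2.1 x.2.2 (η := η)
      (by simpa [g, he₁, he₂] using hη)
    exact Prod.ext this.1 (Prod.ext this.2.1 this.2.2)
  have hmul (x y) : ∃ s : (𝓞 M)ˣ, g x * g y = g (x + y) * s ^ 2 := by
    have hpow (a : (𝓞 M)ˣ) (i j : Fin 2) :
        a ^ (i : ℕ) * a ^ (j : ℕ) = a ^ ((i + j : Fin 2) : ℕ) * (a ^ (i * j : ℕ)) ^ 2 := by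
      fin_cases i <;> fin_cases j <;> simp [sq]
    refine ⟨(-1) ^ (x.1 * y.1 : ℕ) * e₁ ^ (x.2.1 * y.2.1 : ℕ) * e₂ ^ (x.2.2 * y.2.2 : ℕ), ?_⟩
    simp only [g, Prod.fst_add, Prod.snd_add]
    rw [mul_pow, mul_pow, mul_mul_mul_comm, mul_mul_mul_comm ((-1) ^ (x.1 : ℕ)), hpow, hpow, hpow,
      mul_mul_mul_comm ((-1) ^ ((x.1 + y.1 : Fin 2) : ℕ)), mul_mul_mul_comm (_ * _)]
  have hinj : Function.Injective fun x => (QuotientGroup.mk (g x) : (𝓞 M)ˣ ⧸ N) := by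
    intro x y hxy
    obtain ⟨t, ht⟩ := QuotientGroup.eq.1 hxy
    obtain ⟨s, hs⟩ := hmul x y
    have h1 : g (x + y) * (s * (g x * t)⁻¹) ^ 2 = 1 := by
      rw [mul_pow, ← mul_assoc, ← hs, inv_pow, mul_inv_eq_one, mul_pow,
        show t ^ 2 = (g x)⁻¹ * g y from ht, sq, mul_assoc (g x) (g x),
        mul_inv_cancel_left]
    have h0 := hg _ _ (by rw [h1]; simp)
    clear hxy ht hs h1
    revert h0
    revert x y
    decide
  obtain ⟨hfin, hcard⟩ := card_units_quotient_squares_le (M := M) hdeg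
  obtain ⟨x, hx⟩ := (hinj.bijective_of_nat_card_le (by simpa using hcard)).2 (QuotientGroup.mk ε)
  obtain ⟨t, ht⟩ := QuotientGroup.eq.1 hx
  have hε : ε = g x * t ^ 2 := by
    rw [show t ^ 2 = (g x)⁻¹ * ε from ht, mul_inv_cancel_left]
  have h0 := hg x t (hε ▸ h)
  exact ⟨t, by rw [hε, h0]; simp [g]⟩

theorem exists_real_of_root {z : ℂ} (hz : z ^ 3 - 8 * z ^ 2 + 15 * z - 7 = 0) :
    ∃ r : ℝ, 0 < r ∧ z = r := by
  have hcont : Continuous fun x : ℝ => x ^ 3 - 8 * x ^ 2 + 15 * x - 7 := by fun_prop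
  obtain ⟨r₁, ⟨h₁, h₁'⟩, hr₁⟩ := intermediate_value_Icc (a := (0 : ℝ)) (b := 1) (by norm_num)
    hcont.continuousOn (show (0 : ℝ) ∈ _ by constructor <;> norm_num)
  obtain ⟨r₂, ⟨h₂, h₂'⟩, hr₂⟩ := intermediate_value_Icc' (a := (1 : ℝ)) (b := 2) (by norm_num)
    hcont.continuousOn (show (0 : ℝ) ∈ _ by constructor <;> norm_num)
  obtain ⟨r₃, ⟨h₃, h₃'⟩, hr₃⟩ := intermediate_value_Icc (a := (5 : ℝ)) (b := 6) (by norm_num)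
    hcont.continuousOn (show (0 : ℝ) ∈ _ by constructor <;> norm_num)
  simp only at hr₁ hr₂ hr₃
  have hne₁ : r₁ ≠ 0 := by rintro rfl; norm_num at hr₁
  have hne₁' : r₁ ≠ 1 := by rintro rfl; norm_num at hr₁
  have hlt : r₁ < r₂ := (lt_of_le_of_ne h₁' hne₁').trans_le h₂
  have h12 : r₁ ^ 2 + r₁ * r₂ + r₂ ^ 2 - 8 * (r₁ + r₂) + 15 = 0 :=
    mul_left_cancel₀ (sub_ne_zero.2 hlt.ne) (by linear_combination hr₁ - hr₂)
  have h13 : r₁ ^ 2 + r₁ * r₃ + r₃ ^ 2 - 8 * (r₁ + r₃) + 15 = 0 :=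
    mul_left_cancel₀ (sub_ne_zero.2 (show r₁ ≠ r₃ by linarith)) (by linear_combination hr₁ - hr₃)
  have hsum : r₁ + r₂ + r₃ = 8 :=
    mul_left_cancel₀ (sub_ne_zero.2 (show r₂ ≠ r₃ by linarith)) (by linear_combination h12 - h13)
  have hfac : (z - r₁) * ((z - r₂) * (z - r₃)) = 0 := by
    have hs : (r₁ + r₂ + r₃ : ℂ) = 8 := by exact_mod_cast hsum
    have h12' : (r₁ ^ 2 + r₁ * r₂ + r₂ ^ 2 - 8 * (r₁ + r₂) + 15 : ℂ) = 0 := by exact_mod_cast h12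
    have hr₁' : (r₁ ^ 3 - 8 * r₁ ^ 2 + 15 * r₁ - 7 : ℂ) = 0 := by exact_mod_cast hr₁
    obtain h : (r₃ : ℂ) = 8 - r₁ - r₂ := by linear_combination hs
    rw [h]
    linear_combination hz - hr₁' - (z - r₁) * h12'
  rcases mul_eq_zero.1 hfac with h | h
  · exact ⟨r₁, lt_of_le_of_ne h₁ hne₁.symm, sub_eq_zero.1 h⟩
  rcases mul_eq_zero.1 h with h | h
  · exact ⟨r₂, by linarith, sub_eq_zero.1 h⟩
  · exact ⟨r₃, by linarith, sub_eq_zero.1 h⟩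

theorem exists_real_embedding_apply (hroot : μ ^ 3 - 8 * μ ^ 2 + 15 * μ - 7 = 0)
    (hgen : Algebra.adjoin ℚ {algebraMap (𝓞 M) M μ} = ⊤)
    (hdeg : Module.finrank ℚ M = 3) (φ : 𝓞 M →+* ℂ) :
    (∃ r : ℝ, 0 < r ∧ φ μ = r) ∧ ∀ x, ∃ y : ℝ, φ x = y := by
  obtain ⟨r, hr, hφ⟩ := exists_real_of_root (z := φ μ) (by
    have h := congrArg φ hroot
    rwa [map_sub, map_add, map_sub, map_mul, map_mul, map_pow, map_pow, map_ofNat, map_ofNat,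
      map_ofNat, map_zero] at h)
  refine ⟨⟨r, hr, hφ⟩, fun x => ?_⟩
  obtain ⟨a, b, c, h⟩ := exists_int_coords hroot hgen hdeg x
  have h' := congrArg φ h
  simp only [map_mul, map_add, map_pow, map_intCast, map_ofNat, hφ] at h'
  refine ⟨(a + b * r + c * r ^ 2) / 361, ?_⟩
  push_cast
  rw [eq_div_iff (by norm_num), ← h', mul_comm]

theorem eq_zero_of_sq_eq_one_sub (hroot : μ ^ 3 - 8 * μ ^ 2 + 15 * μ - 7 = 0)
    (hgen : Algebra.adjoin ℚ {algebraMap (𝓞 M) M μ} = ⊤)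
    (hdeg : Module.finrank ℚ M = 3) {η W : 𝓞 M} (hη : η ≠ 0)
    (h : η ^ 2 = 1 - 4 * μ * W ^ 2) : W = 0 := by
  by_contra hW
  have hlt (w : InfinitePlace M) : w η < 1 := by
    let φ : 𝓞 M →+* ℂ := w.embedding.comp (algebraMap (𝓞 M) M)
    have hinj : Function.Injective φ :=
      w.embedding.injective.comp RingOfIntegers.coe_injective
    obtain ⟨⟨r, hr, hμ⟩, hreal⟩ := exists_real_embedding_apply hroot hgen hdeg φ
    obtain ⟨y, hy⟩ := hreal η
    obtain ⟨v, hv⟩ := hreal W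
    have hv0 : v ≠ 0 := by
      rintro rfl
      exact hW (hinj (by simpa using hv))
    have h' := congrArg φ h
    simp only [map_mul, map_sub, map_pow, map_one, map_ofNat, hμ, hy, hv] at h'
    have h'' : y ^ 2 = 1 - 4 * r * v ^ 2 := by exact_mod_cast h'
    have hw : w η = |y| := by
      rw [← InfinitePlace.norm_embedding_eq, show w.embedding (η : M) = y from hy]
      simp
    rw [hw, ← sq_lt_one_iff_abs_lt_one, h'']
    have : 0 < r * v ^ 2 := by positivity
    linarith
  obtain ⟨w⟩ : Nonempty (InfinitePlace M) := inferInstance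
  exact (hlt w).not_ge (InfinitePlace.one_le_of_lt_one hη fun z _ => hlt z)

end CubicResolvent

open CubicResolvent

theorem cubic_resolvent_equation_solutions
    (M : Type*) [Field M] [NumberField M]
    (μ : 𝓞 M)
    (hroot : μ ^ 3 - 8 * μ ^ 2 + 15 * μ - 7 = 0)
    (hgen : Algebra.adjoin ℚ {algebraMap (𝓞 M) M μ} = ⊤)
    (hdeg : Module.finrank ℚ M = 3)
    (U V : 𝓞 M)
    (hunit : IsUnit (U * (U ^ 2 - 4 * μ * V ^ 2))) :
    V = 0 ∧ IsUnit U := by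
  obtain ⟨⟨u, rfl⟩, ⟨δ, hδ⟩⟩ := IsUnit.mul_iff.1 hunit
  refine ⟨?_, u.isUnit⟩
  set W : 𝓞 M := ↑u⁻¹ * V with hW
  have hε : ((δ * (u⁻¹) ^ 2 : (𝓞 M)ˣ) : 𝓞 M) = 1 - 4 * μ * W ^ 2 := by
    have hu : (u : 𝓞 M) * ↑u⁻¹ = 1 := u.mul_inv
    rw [Units.val_mul, Units.val_pow_eq_pow_val, hδ, hW]
    linear_combination ((u : 𝓞 M) * ↑u⁻¹ + 1) * hu
  obtain ⟨η, hη⟩ := sq_of_four_dvd_sub_one hroot hgen hdeg (δ * (u⁻¹) ^ 2)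
    ⟨-(μ * W ^ 2), by rw [hε]; ring⟩
  have hW0 : W = 0 := eq_zero_of_sq_eq_one_sub hroot hgen hdeg η.ne_zero
    (by rw [← hε, hη, Units.val_pow_eq_pow_val])
  simpa [hW] using hW0
end

section
/- Let M = ℚ(μ) where μ is a root of the irreducible polynomial g₃(x) = x³ − 8x² + 15x − 7, with ring of integers O_M. If P, Q ∈ O_M are such that P⁴ + μQ⁴ is a unit of O_M, then Q = 0 and P is a unit of O_M. -/
open NumberField

/-- An algebraic integer which is smaller than a unit at every complex embedding is zero. -/
theorem eq_zero_of_forall_norm_embedding_lt {M : Type*} [Field M] [NumberField M] {x u : 𝓞 M}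
    (hu : IsUnit u) (h : ∀ σ : M →ₐ[ℚ] ℂ, ‖σ x‖ < ‖σ u‖) : x = 0 := by
  have key (y : 𝓞 M) : ((|RingOfIntegers.norm ℚ y| : ℚ) : ℝ) = ∏ σ : M →ₐ[ℚ] ℂ, ‖σ y‖ := by
    have := congrArg norm (Algebra.norm_eq_prod_embeddings ℚ ℂ (y : M))
    rw [norm_prod] at this
    rw [← this]
    simp
  by_contra hx
  have : Nonempty (M →ₐ[ℚ] ℂ) := ⟨IsAlgClosed.lift⟩
  have hlt : ∏ σ : M →ₐ[ℚ] ℂ, ‖σ x‖ < ∏ σ : M →ₐ[ℚ] ℂ, ‖σ u‖ :=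
    Finset.prod_lt_prod_of_nonempty (fun σ _ ↦ by simpa using hx) (fun σ _ ↦ h σ)
      Finset.univ_nonempty
  rw [← key, ← key, NumberField.isUnit_iff_norm.mp hu, Rat.cast_lt,
    RingOfIntegers.coe_norm, ← Algebra.coe_norm_int] at hlt
  have hN : Algebra.norm ℤ x = 0 := Int.abs_lt_one_iff.mp (by exact_mod_cast hlt)
  exact hx (Algebra.norm_eq_zero_iff.mp hN)

/-- All complex roots of `x³ − 8x² + 15x − 7` are real and positive. -/
theorem exists_pos_ofReal_eq_of_cubic_eq_zero {z : ℂ}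
    (hz : z ^ 3 - 8 * z ^ 2 + 15 * z - 7 = 0) : ∃ r : ℝ, 0 < r ∧ (r : ℂ) = z := by
  let g : ℝ → ℝ := fun x ↦ x ^ 3 - 8 * x ^ 2 + 15 * x - 7
  have hg : Continuous g := by fun_prop
  obtain ⟨a, ⟨ha0, ha1⟩, ha⟩ : (0 : ℝ) ∈ g '' Set.Ioo 0 1 :=
    intermediate_value_Ioo (by norm_num) hg.continuousOn (by norm_num [g])
  obtain ⟨b, ⟨hb1, hb2⟩, hb⟩ : (0 : ℝ) ∈ g '' Set.Ioo 1 2 :=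
    intermediate_value_Ioo' (by norm_num) hg.continuousOn (by norm_num [g])
  obtain ⟨c, ⟨hc5, hc6⟩, hc⟩ : (0 : ℝ) ∈ g '' Set.Ioo 5 6 :=
    intermediate_value_Ioo (by norm_num) hg.continuousOn (by norm_num [g])
  simp only [g] at ha hb hc
  have hab : a ^ 2 + a * b + b ^ 2 - 8 * (a + b) + 15 = 0 :=
    mul_left_cancel₀ (sub_ne_zero.mpr (by linarith : a ≠ b)) (by linear_combination ha - hb)
  have hac : a ^ 2 + a * c + c ^ 2 - 8 * (a + c) + 15 = 0 :=
    mul_left_cancel₀ (sub_ne_zero.mpr (by linarith : a ≠ c)) (by linear_combination ha - hc)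
  have hsum : a + b + c = 8 := by
    have : a + b + c - 8 = 0 :=
      mul_left_cancel₀ (sub_ne_zero.mpr (by linarith : b ≠ c)) (by linear_combination hab - hac)
    linarith
  have hcC : (c : ℂ) = 8 - a - b := by
    exact_mod_cast (by linarith : c = 8 - a - b)
  have haC : (a : ℂ) ^ 3 - 8 * a ^ 2 + 15 * a - 7 = 0 := by exact_mod_cast ha
  have habC : (a : ℂ) ^ 2 + a * b + b ^ 2 - 8 * (a + b) + 15 = 0 := by exact_mod_cast hab
  have hfac : (z - a) * ((z - b) * (z - c)) = 0 := by
    rw [hcC]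
    linear_combination hz - haC - (z - a) * habC
  rcases mul_eq_zero.mp hfac with h | h
  · exact ⟨a, ha0, (sub_eq_zero.mp h).symm⟩
  rcases mul_eq_zero.mp h with h | h
  · exact ⟨b, by linarith, (sub_eq_zero.mp h).symm⟩
  · exact ⟨c, by linarith, (sub_eq_zero.mp h).symm⟩

/-- An embedding sending a generator of the field to a real number is real. -/
theorem exists_ofReal_eq_of_adjoin_eq_top {M : Type*} [Field M] [Algebra ℚ M] {m : M}
    (hgen : Algebra.adjoin ℚ {m} = ⊤) (σ : M →ₐ[ℚ] ℂ) {r : ℝ} (hr : (r : ℂ) = σ m) (x : M) :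
    ∃ s : ℝ, (s : ℂ) = σ x := by
  have hle : Algebra.adjoin ℚ {m} ≤ (Complex.ofRealAm.restrictScalars ℚ).range.comap σ :=
    Algebra.adjoin_le (Set.singleton_subset_iff.mpr ⟨r, hr⟩)
  rw [hgen] at hle
  exact hle (Algebra.mem_top (x := x))

/-- A cubic generator with minimal polynomial `x³ − 8x² + 15x − 7` has norm `7`, so is not a unit. -/
theorem not_isUnit_of_cubic_eq_zero {M : Type*} [Field M] [NumberField M] {μ : 𝓞 M}
    (hroot : μ ^ 3 - 8 * μ ^ 2 + 15 * μ - 7 = 0)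
    (hgen : Algebra.adjoin ℚ {algebraMap (𝓞 M) M μ} = ⊤) (hdeg : Module.finrank ℚ M = 3) :
    ¬ IsUnit μ := by
  let g : Polynomial ℚ := .X ^ 3 - 8 * .X ^ 2 + 15 * .X - 7
  have hg : g.natDegree = 3 := by unfold g; compute_degree!
  have hgm : g.Monic := by unfold g; monicity!
  have hint : IsIntegral ℚ (μ : M) := Algebra.IsIntegral.isIntegral _
  obtain ⟨B, hB⟩ : ∃ B : PowerBasis ℚ M, B.gen = μ :=
    ⟨.ofAdjoinEqTop' hint hgen, PowerBasis.ofAdjoinEqTop'_gen hint hgen⟩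
  have hdim : B.dim = 3 := B.finrank.symm.trans hdeg
  have haeval : Polynomial.aeval (μ : M) g = 0 := by
    simpa only [g, map_sub, map_add, map_mul, map_pow, map_ofNat, Polynomial.aeval_X, map_zero]
      using congrArg (algebraMap (𝓞 M) M) hroot
  have hmin : g = minpoly ℚ (μ : M) := by
    refine Polynomial.eq_of_monic_of_dvd_of_natDegree_le (minpoly.monic hint) hgm
      (minpoly.dvd _ _ haeval) ?_
    rw [hg, ← hB, B.natDegree_minpoly, hdim]
  have hnorm : Algebra.norm ℚ (μ : M) = 7 := by
    rw [← hB, Algebra.PowerBasis.norm_gen_eq_coeff_zero_minpoly, hB, ← hmin, hdim]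
    simp [g, Polynomial.coeff_zero_eq_eval_zero]
    norm_num
  intro h
  rw [NumberField.isUnit_iff_norm, RingOfIntegers.coe_norm, hnorm] at h
  norm_num at h

/-- Let `M = ℚ(μ)` where `μ` is a root of the irreducible polynomial
`g₃(x) = x³ − 8x² + 15x − 7`.  If `P, Q ∈ 𝓞 M` are such that `P⁴ + μQ⁴` is a unit of `𝓞 M`,
then `Q = 0` and `P` is a unit of `𝓞 M`. -/
theorem quartic_relative_thue_equation_solutions
    (M : Type*) [Field M] [NumberField M]
    (μ : 𝓞 M)
    (hroot : μ ^ 3 - 8 * μ ^ 2 + 15 * μ - 7 = 0)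
    (hgen : Algebra.adjoin ℚ {algebraMap (𝓞 M) M μ} = ⊤)
    (hdeg : Module.finrank ℚ M = 3)
    (P Q : 𝓞 M)
    (hunit : IsUnit (P ^ 4 + μ * Q ^ 4)) :
    Q = 0 ∧ IsUnit P := by
  have hμ : ¬ IsUnit μ := not_isUnit_of_cubic_eq_zero hroot hgen hdeg
  have hP : P ≠ 0 := by
    rintro rfl
    refine hμ (isUnit_of_mul_isUnit_left (y := Q ^ 4) ?_)
    simpa using hunit
  have hμQ : μ * Q ^ 4 = 0 := by
    refine eq_zero_of_forall_norm_embedding_lt hunit fun σ ↦ ?_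
    have hσμ : (σ μ) ^ 3 - 8 * (σ μ) ^ 2 + 15 * σ μ - 7 = 0 := by
      simpa [map_ofNat] using congrArg (σ.toRingHom.comp (algebraMap (𝓞 M) M)) hroot
    obtain ⟨r, hr0, hr⟩ := exists_pos_ofReal_eq_of_cubic_eq_zero hσμ
    obtain ⟨p, hp⟩ := exists_ofReal_eq_of_adjoin_eq_top hgen σ hr P
    obtain ⟨q, hq⟩ := exists_ofReal_eq_of_adjoin_eq_top hgen σ hr Q
    have hp0 : p ≠ 0 := by
      rintro rfl
      exact hP (by simpa using hp.symm)
    have h₁ : σ (μ * Q ^ 4 : 𝓞 M) = ((r * q ^ 4 : ℝ) : ℂ) := by simp [hr, hq]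
    have h₂ : σ (P ^ 4 + μ * Q ^ 4 : 𝓞 M) = ((p ^ 4 + r * q ^ 4 : ℝ) : ℂ) := by
      simp [hr, hp, hq]
    rw [h₁, h₂, Complex.norm_of_nonneg (by positivity), Complex.norm_of_nonneg (by positivity)]
    have : 0 < p ^ 4 := by positivity
    linarith
  have hQ : Q = 0 := by
    rcases mul_eq_zero.mp hμQ with rfl | h
    · simp at hroot
    · exact pow_eq_zero_iff (by norm_num) |>.mp h
  subst hQ
  exact ⟨rfl, by simpa using hunit⟩
end

section
/- Let K = ℚ(ξ) where ξ is a root of f₁₂(x) = x¹² + 8x⁸ + 15x⁴ + 7, let μ = −ξ⁴, and let M = ℚ(μ). If α ∈ O_K satisfies O_M[α] = O_K (that is, α generates a relative power integral basis of K over M), then there exist A ∈ O_M and a unit ε of O_M such that α = A + ε·ξ. In other words, up to equivalence, ξ is the only generator of relative power integral bases of K over M. -/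
open NumberField

open Polynomial

section Eisenstein

variable {R F L : Type*} [CommRing R] [IsDomain R] [IsIntegrallyClosed R] [Field F] [Algebra R F]
  [IsFractionRing R F] [Field L] [Algebra F L] [Algebra R L] [IsScalarTower R F L]

theorem minpoly_eq_of_isEisensteinAt {x : L} {h : R[X]} {p : R} (hp : Prime p) (hm : h.Monic)
    (hdeg : 0 < h.natDegree) (hE : h.IsEisensteinAt (Ideal.span {p})) (hx : aeval x h = 0) :
    minpoly R x = h ∧ minpoly F x = h.map (algebraMap R F) := by
  have hint : IsIntegral R x := ⟨h, hm, by simpa [aeval_def] using hx⟩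
  have hirr : Irreducible h :=
    hE.irreducible ((Ideal.span_singleton_prime hp.ne_zero).2 hp) hm.isPrimitive hdeg
  have h2 : h.map (algebraMap R F) = minpoly F x :=
    minpoly.eq_of_irreducible_of_monic
      ((hm.irreducible_iff_irreducible_map_fraction_map).1 hirr) (by simpa using hx) (hm.map _)
  refine ⟨?_, h2.symm⟩
  rw [minpoly.isIntegrallyClosed_eq_field_fractions' F hint] at h2
  exact (map_injective _ (IsFractionRing.injective R F) h2).symm

theorem mem_adjoin_of_isEisensteinAt {x z : L} {h : R[X]} {p : R} {n : ℕ} (hp : Prime p)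
    (hm : h.Monic) (hdeg : 0 < h.natDegree) (hE : h.IsEisensteinAt (Ideal.span {p}))
    (hx : aeval x h = 0) (htop : Algebra.adjoin F {x} = ⊤) (hz : IsIntegral R z)
    (hmem : p ^ n • z ∈ Algebra.adjoin R {x}) : z ∈ Algebra.adjoin R {x} := by
  have hint : IsIntegral R x := ⟨h, hm, by simpa [aeval_def] using hx⟩
  have hmin := (minpoly_eq_of_isEisensteinAt (F := F) hp hm hdeg hE hx).1
  have := mem_adjoin_of_smul_prime_pow_smul_of_minpoly_isEisensteinAt (K := F)
    (B := PowerBasis.ofAdjoinEqTop (hint.tower_top (A := F)) htop) hp (by simpa using hint) hz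
    (by simpa using hmem) (by simpa [hmin] using hE)
  simpa using this

end Eisenstein

theorem derivative_norm_smul_mem_adjoin {R F L : Type*} [CommRing R] [IsIntegrallyClosed R]
    [Field F] [Algebra R F] [IsFractionRing R F] [Field L] [Algebra F L] [Algebra R L]
    [IsScalarTower R F L] [Module.Finite F L]
    [Algebra.IsSeparable F L] {x z : L}
    (hint : IsIntegral R x) (htop : Algebra.adjoin F {x} = ⊤) (hz : IsIntegral R z) :
    Algebra.norm F (aeval x (derivative (minpoly F x))) • z ∈ Algebra.adjoin R {x} := by
  have h1 := Algebra.discr_mul_isIntegral_mem_adjoin F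
    (B := PowerBasis.ofAdjoinEqTop (hint.tower_top (A := F)) htop) (R := R) (by simpa using hint) hz
  rw [Algebra.discr_powerBasis_eq_norm] at h1
  simp only [PowerBasis.ofAdjoinEqTop_gen] at h1
  rcases neg_one_pow_eq_or F (Module.finrank F L * (Module.finrank F L - 1) / 2) with h | h <;>
    rw [h] at h1
  · simpa using h1
  · simpa using h1

theorem exists_sum_range_of_mem_adjoin {R A : Type*} [CommRing R] [Nontrivial R] [CommRing A]
    [Algebra R A] {x z : A} {h : R[X]} {n : ℕ} (hm : h.Monic) (hdeg : 0 < h.natDegree)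
    (hn : h.natDegree ≤ n) (hx : aeval x h = 0) (hz : z ∈ Algebra.adjoin R {x}) :
    ∃ c : ℕ → R, z = ∑ i ∈ Finset.range n, c i • x ^ i := by
  rw [Algebra.adjoin_singleton_eq_range_aeval] at hz
  obtain ⟨q, rfl⟩ := hz
  refine ⟨(q %ₘ h).coeff, ?_⟩
  rw [← aeval_eq_sum_range'
    ((natDegree_modByMonic_lt q hm (by rintro rfl; simp at hdeg)).trans_le hn)]
  exact (aeval_modByMonic_eq_self_of_root hx).symm

theorem eq_zero_of_aeval_eq_zero_of_natDegree_lt {F L : Type*} [Field F] [CommRing L] [Algebra F L]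
    {x : L} {q : F[X]} (hq : aeval x q = 0) (hdeg : q.natDegree < (minpoly F x).natDegree) :
    q = 0 :=
  eq_zero_of_dvd_of_natDegree_lt (minpoly.dvd F x hq) hdeg

section Cubic

variable {M : Type*} [Field M] {μ : M}

theorem isEisensteinAt_shifted_cubic :
    (X ^ 3 + 19 * X ^ 2 + 114 * X + 209 : ℤ[X]).Monic ∧
    (X ^ 3 + 19 * X ^ 2 + 114 * X + 209 : ℤ[X]).natDegree = 3 ∧
    (X ^ 3 + 19 * X ^ 2 + 114 * X + 209 : ℤ[X]).IsEisensteinAt (Ideal.span {19}) := by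
  have h0 : (X ^ 3 + 19 * X ^ 2 + 114 * X + 209 : ℤ[X]) =
      X ^ 3 + C 19 * X ^ 2 + C 114 * X + C 209 := by simp
  rw [h0]
  have hm : (X ^ 3 + C 19 * X ^ 2 + C 114 * X + C 209 : ℤ[X]).Monic := by monicity!
  have hd : (X ^ 3 + C 19 * X ^ 2 + C 114 * X + C 209 : ℤ[X]).natDegree = 3 := by compute_degree!
  refine ⟨hm, hd, hm.isEisensteinAt_of_mem_of_notMem ?_ ?_ ?_⟩
  · rw [Ne, Ideal.span_singleton_eq_top, Int.isUnit_iff]; norm_num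
  · intro n hn
    rw [hd] at hn
    rw [Ideal.mem_span_singleton]
    interval_cases n <;> simp [coeff_X, coeff_X_pow]
  · rw [Ideal.span_singleton_pow, Ideal.mem_span_singleton]
    simp

theorem aeval_shifted_cubic (hμ : μ ^ 3 - 8 * μ ^ 2 + 15 * μ - 7 = 0) :
    aeval (μ - 9) (X ^ 3 + 19 * X ^ 2 + 114 * X + 209 : ℤ[X]) = 0 := by
  simp only [map_add, map_mul, map_pow, aeval_X, map_ofNat]
  linear_combination hμ

theorem adjoin_sub_eq_top {F L : Type*} [Field F] [CommRing L] [Algebra F L] {x c : L}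
    (hx : Algebra.adjoin F {x} = ⊤) (hc : c ∈ Algebra.adjoin F {x - c}) :
    Algebra.adjoin F {x - c} = ⊤ := by
  rw [eq_top_iff, ← hx, Algebra.adjoin_le_iff, Set.singleton_subset_iff]
  simpa using add_mem (Algebra.self_mem_adjoin_singleton F (x - c)) hc

theorem adjoin_sub_nine_eq_top [CharZero M] (hM : Algebra.adjoin ℚ {μ} = ⊤) :
    Algebra.adjoin ℚ {μ - 9} = ⊤ :=
  adjoin_sub_eq_top hM (ofNat_mem _ 9)

variable [NumberField M]

theorem minpoly_sub_nine (hμ : μ ^ 3 - 8 * μ ^ 2 + 15 * μ - 7 = 0) :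
    minpoly ℚ (μ - 9) = X ^ 3 + 19 * X ^ 2 + 114 * X + 209 := by
  obtain ⟨hm, hd, hE⟩ := isEisensteinAt_shifted_cubic
  rw [(minpoly_eq_of_isEisensteinAt (F := ℚ) (Int.prime_iff_natAbs_prime.2 (by norm_num)) hm
    (by omega) hE (aeval_shifted_cubic hμ)).2]
  simp

theorem natDegree_minpoly_sub_nine (hμ : μ ^ 3 - 8 * μ ^ 2 + 15 * μ - 7 = 0) :
    (minpoly ℚ (μ - 9)).natDegree = 3 := by
  rw [minpoly_sub_nine hμ]
  compute_degree!

theorem finrank_eq_three (hμ : μ ^ 3 - 8 * μ ^ 2 + 15 * μ - 7 = 0)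
    (hM : Algebra.adjoin ℚ {μ} = ⊤) : Module.finrank ℚ M = 3 := by
  rw [(PowerBasis.ofAdjoinEqTop (Algebra.IsIntegral.isIntegral (μ - 9))
    (adjoin_sub_nine_eq_top hM)).finrank, ← PowerBasis.natDegree_minpoly]
  simpa using natDegree_minpoly_sub_nine hμ

theorem eq_zero_of_quadratic_eq_zero (hμ : μ ^ 3 - 8 * μ ^ 2 + 15 * μ - 7 = 0) {a b c : ℤ}
    (h : (a + b * μ + c * μ ^ 2 : M) = 0) : a = 0 ∧ b = 0 ∧ c = 0 := by
  have key : (C (a + 9 * b + 81 * c : ℚ) + C (b + 18 * c : ℚ) * X +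
      C (c : ℚ) * X ^ 2 : ℚ[X]) = 0 := by
    apply eq_zero_of_aeval_eq_zero_of_natDegree_lt (x := μ - 9)
    · simp
      linear_combination h
    · rw [natDegree_minpoly_sub_nine hμ]
      apply Nat.lt_succ_of_le
      compute_degree
  have h0 := congrArg (coeff · 0) key
  have h1 := congrArg (coeff · 1) key
  have h2 := congrArg (coeff · 2) key
  simp only [coeff_add, coeff_C_mul, coeff_X, coeff_X_pow, coeff_C, coeff_zero] at h0 h1 h2
  norm_num at h0 h1 h2
  subst h2
  norm_num at h0 h1
  subst h1
  norm_num at h0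
  exact ⟨h0, rfl, rfl⟩

theorem exists_quadratic_of_isIntegral (hμ : μ ^ 3 - 8 * μ ^ 2 + 15 * μ - 7 = 0)
    (hM : Algebra.adjoin ℚ {μ} = ⊤) {z : M} (hz : IsIntegral ℤ z) :
    ∃ a b c : ℤ, z = a + b * μ + c * μ ^ 2 := by
  obtain ⟨hm, hd, hE⟩ := isEisensteinAt_shifted_cubic
  have hx := aeval_shifted_cubic hμ
  have hint : IsIntegral ℤ (μ - 9) := ⟨_, hm, by simpa [aeval_def] using hx⟩
  have hp : Prime (19 : ℤ) := Int.prime_iff_natAbs_prime.2 (by norm_num)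
  have hd0 := derivative_norm_smul_mem_adjoin (F := ℚ) hint (adjoin_sub_nine_eq_top hM) hz
  rw [minpoly_sub_nine hμ] at hd0
  set y : M := aeval (μ - 9) (derivative (X ^ 3 + 19 * X ^ 2 + 114 * X + 209 : ℚ[X])) with hy
  have hy' : y = 3 * (μ - 9) ^ 2 + 38 * (μ - 9) + 114 := by
    rw [hy]
    simp only [map_add, map_mul, map_pow, aeval_X, map_ofNat, derivative_mul,
      derivative_X_pow, derivative_X, derivative_ofNat, map_one, map_zero, map_natCast]
    push_cast
    ring
  set w : M := 57 + 23 * (μ - 9) + 2 * (μ - 9) ^ 2 with hw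
  have hyw : y * w = algebraMap ℚ M 19 := by
    rw [hy', hw]
    simp
    linear_combination (6 * μ - 23) * hμ
  have hpoly (q : ℤ[X]) : IsIntegral ℤ (aeval (μ - 9) q) :=
    adjoin_le_integralClosure hint (aeval_mem_adjoin_singleton _ _)
  have hyint : IsIntegral ℤ y := by
    rw [hy']
    convert hpoly (3 * X ^ 2 + 38 * X + 114) using 1
    simp only [map_add, map_mul, map_pow, aeval_X, map_ofNat]
  have hwint : IsIntegral ℤ w := by
    rw [hw]
    convert hpoly (57 + 23 * X + 2 * X ^ 2) using 1
    simp only [map_add, map_mul, map_pow, aeval_X, map_ofNat]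
  obtain ⟨m, hm1⟩ := IsIntegrallyClosed.isIntegral_iff.1 (Algebra.isIntegral_norm ℚ hyint)
  obtain ⟨k, hk⟩ := IsIntegrallyClosed.isIntegral_iff.1 (Algebra.isIntegral_norm ℚ hwint)
  have hmk : k * m = 19 ^ 3 := by
    have := congrArg (Algebra.norm ℚ) hyw
    rw [map_mul, ← hm1, ← hk, Algebra.norm_algebraMap, finrank_eq_three hμ hM] at this
    have h2 : ((m * k : ℤ) : ℚ) = ((19 ^ 3 : ℤ) : ℚ) := by
      rw [Int.cast_mul, Int.cast_pow]
      simpa only [eq_intCast, Int.cast_ofNat] using this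
    rw [mul_comm]
    exact_mod_cast h2
  have hmem : (19 : ℤ) ^ 3 • z ∈ Algebra.adjoin ℤ {μ - 9} := by
    rw [← hmk, mul_smul]
    apply Subalgebra.smul_mem
    rw [← hm1] at hd0
    simpa only [eq_intCast, Int.cast_smul_eq_zsmul] using hd0
  obtain ⟨c, hc⟩ := exists_sum_range_of_mem_adjoin hm (by omega) hd.le hx
    (mem_adjoin_of_isEisensteinAt (F := ℚ) hp hm (by omega) hE hx (adjoin_sub_nine_eq_top hM) hz hmem)
  simp [Finset.sum_range_succ] at hc
  refine ⟨c 0 - 9 * c 1 + 81 * c 2, c 1 - 18 * c 2, c 2, ?_⟩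
  rw [hc]
  push_cast
  ring

end Cubic

/-- Multiplication of coordinate vectors with respect to the basis `1, θ, θ²`, where
`θ³ = 8 θ² - 15 θ + 7`. -/
def cubicMul {S : Type*} [CommRing S] (u v : S × S × S) : S × S × S :=
  (u.1 * v.1 + 7 * (u.2.1 * v.2.2 + u.2.2 * v.2.1) + 56 * (u.2.2 * v.2.2),
    u.1 * v.2.1 + u.2.1 * v.1 - 15 * (u.2.1 * v.2.2 + u.2.2 * v.2.1) - 113 * (u.2.2 * v.2.2),
    u.1 * v.2.2 + u.2.1 * v.2.1 + u.2.2 * v.1 + 8 * (u.2.1 * v.2.2 + u.2.2 * v.2.1)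
      + 49 * (u.2.2 * v.2.2))

/-- The element with coordinates `u` with respect to `1, θ, θ²`. -/
def cubicElt {R : Type*} [CommRing R] (θ : R) (u : ℤ × ℤ × ℤ) : R :=
  u.1 + u.2.1 * θ + u.2.2 * θ ^ 2

/-- The elements `1, θ, θ²` form a `ℤ`-basis of `R`, and `θ` is a root of
`x³ - 8 x² + 15 x - 7`. -/
structure IsCubicBasis {R : Type*} [CommRing R] (θ : R) : Prop where
  cubic : θ ^ 3 - 8 * θ ^ 2 + 15 * θ - 7 = 0
  exists_eq : ∀ z : R, ∃ u, z = cubicElt θ u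
  eq_zero : ∀ u, cubicElt θ u = 0 → u = 0

namespace IsCubicBasis

variable {R : Type*} [CommRing R] {θ : R}

theorem elt_mul_elt (h : IsCubicBasis θ) (u v : ℤ × ℤ × ℤ) :
    cubicElt θ u * cubicElt θ v = cubicElt θ (cubicMul u v) := by
  simp only [cubicElt, cubicMul]
  push_cast
  linear_combination ((u.2.1 * v.2.2 + u.2.2 * v.2.1 : R) + u.2.2 * v.2.2 * (θ + 8)) * h.cubic

theorem eq_of_elt_eq (h : IsCubicBasis θ) {u v : ℤ × ℤ × ℤ} (huv : cubicElt θ u = cubicElt θ v) :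
    u = v := by
  rw [← sub_eq_zero]
  apply h.eq_zero
  simp only [cubicElt, Prod.fst_sub, Prod.snd_sub] at huv ⊢
  push_cast
  linear_combination huv

theorem intCast_dvd_iff (h : IsCubicBasis θ) (n : ℤ) (u : ℤ × ℤ × ℤ) :
    (n : R) ∣ cubicElt θ u ↔ n ∣ u.1 ∧ n ∣ u.2.1 ∧ n ∣ u.2.2 := by
  constructor
  · rintro ⟨z, hz⟩
    obtain ⟨v, rfl⟩ := h.exists_eq z
    have : u = (n * v.1, n * v.2.1, n * v.2.2) := by
      apply h.eq_of_elt_eq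
      rw [hz]
      simp only [cubicElt]
      push_cast
      ring
    subst this
    simp
  · rintro ⟨⟨a, ha⟩, ⟨b, hb⟩, ⟨c, hc⟩⟩
    refine ⟨cubicElt θ (a, b, c), ?_⟩
    simp only [cubicElt, ha, hb, hc]
    push_cast
    ring

theorem self_dvd_iff (h : IsCubicBasis θ) (u : ℤ × ℤ × ℤ) : θ ∣ cubicElt θ u ↔ 7 ∣ u.1 := by
  constructor
  · rintro ⟨z, hz⟩
    obtain ⟨v, rfl⟩ := h.exists_eq z
    have : u = cubicMul (0, 1, 0) v := by
      apply h.eq_of_elt_eq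
      rw [hz, ← h.elt_mul_elt]
      simp [cubicElt]
    subst this
    simp [cubicMul]
  · rintro ⟨a, ha⟩
    refine ⟨a * (θ ^ 2 - 8 * θ + 15) + u.2.1 + u.2.2 * θ, ?_⟩
    simp only [cubicElt, ha]
    push_cast
    linear_combination -(a : R) * h.cubic

theorem nontrivial (h : IsCubicBasis θ) : Nontrivial R := by
  by_contra hn
  rw [not_nontrivial_iff_subsingleton] at hn
  have := h.eq_zero (1, 0, 0) (Subsingleton.elim _ _)
  simp at this

theorem self_prime (h : IsCubicBasis θ) : Prime θ := by
  have h7 : Prime (7 : ℤ) := Int.prime_iff_natAbs_prime.2 (by norm_num)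
  refine ⟨?_, ?_, ?_⟩
  · intro h0
    have := h.eq_zero (0, 1, 0) (by simp [cubicElt, h0])
    simp at this
  · intro hu
    have := (h.self_dvd_iff (1, 0, 0)).1 hu.dvd
    omega
  · intro a b hab
    obtain ⟨u, rfl⟩ := h.exists_eq a
    obtain ⟨v, rfl⟩ := h.exists_eq b
    rw [h.elt_mul_elt, h.self_dvd_iff] at hab
    rw [h.self_dvd_iff, h.self_dvd_iff]
    apply h7.dvd_or_dvd
    simp only [cubicMul] at hab
    omega

theorem two_prime (h : IsCubicBasis θ) : Prime (2 : R) := by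
  have key (u : ℤ × ℤ × ℤ) := h.intCast_dvd_iff 2 u
  push_cast at key
  refine ⟨?_, ?_, ?_⟩
  · intro h0
    have := h.eq_zero (2, 0, 0) (by simp [cubicElt, h0])
    simp at this
  · intro hu
    have := (key (1, 0, 0)).1 hu.dvd
    omega
  · intro a b hab
    obtain ⟨u, rfl⟩ := h.exists_eq a
    obtain ⟨v, rfl⟩ := h.exists_eq b
    rw [h.elt_mul_elt, key] at hab
    rw [key, key]
    have hdec : ∀ a b c d e f : ZMod 2, cubicMul (a, b, c) (d, e, f) = 0 →
        (a = 0 ∧ b = 0 ∧ c = 0) ∨ (d = 0 ∧ e = 0 ∧ f = 0) := by decide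
    have hz (n : ℤ) : 2 ∣ n ↔ (n : ZMod 2) = 0 := (ZMod.intCast_zmod_eq_zero_iff_dvd n 2).symm
    simp only [hz] at hab ⊢
    apply hdec
    simpa [cubicMul, Prod.ext_iff] using hab

theorem not_four_dvd_mul_sq_sub_one (h : IsCubicBasis θ) (v : ℤ × ℤ × ℤ) (η : R)
    (hv : ∀ a b c : ZMod 4,
      cubicMul ((v.1 : ZMod 4), (v.2.1 : ZMod 4), (v.2.2 : ZMod 4))
        (cubicMul (a, b, c) (a, b, c)) ≠ (1, 0, 0)) :
    ¬ 4 ∣ cubicElt θ v * η ^ 2 - 1 := by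
  intro hdvd
  obtain ⟨u, rfl⟩ := h.exists_eq η
  have h1 : cubicElt θ v * cubicElt θ u ^ 2 - 1 =
      cubicElt θ (cubicMul v (cubicMul u u) - (1, 0, 0)) := by
    rw [sq, h.elt_mul_elt, h.elt_mul_elt]
    simp only [cubicElt, Prod.fst_sub, Prod.snd_sub]
    push_cast
    ring
  have h2 := h.intCast_dvd_iff 4 (cubicMul v (cubicMul u u) - (1, 0, 0))
  rw [h1] at hdvd
  obtain ⟨d1, d2, d3⟩ := h2.1 (by exact_mod_cast hdvd)
  have hz (n : ℤ) : 4 ∣ n ↔ (n : ZMod 4) = 0 := (ZMod.intCast_zmod_eq_zero_iff_dvd n 4).symm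
  rw [hz] at d1 d2 d3
  simp only [cubicMul, Prod.fst_sub, Prod.snd_sub] at d1 d2 d3
  push_cast at d1 d2 d3
  rw [sub_eq_zero] at d1 d2 d3
  exact hv u.1 u.2.1 u.2.2 (Prod.ext d1 (Prod.ext d2 d3))

end IsCubicBasis

theorem isCubicBasis_ringOfIntegers {M : Type*} [Field M] [NumberField M] {θ : 𝓞 M}
    (hμ : (θ : M) ^ 3 - 8 * (θ : M) ^ 2 + 15 * (θ : M) - 7 = 0)
    (hM : Algebra.adjoin ℚ {(θ : M)} = ⊤) : IsCubicBasis θ where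
  cubic := by
    apply RingOfIntegers.ext
    simp only [map_sub, map_add, map_mul, map_pow, map_ofNat, map_zero]
    exact hμ
  exists_eq z := by
    obtain ⟨a, b, c, h⟩ := exists_quadratic_of_isIntegral hμ hM z.isIntegral_coe
    refine ⟨(a, b, c), RingOfIntegers.ext ?_⟩
    simpa [cubicElt] using h
  eq_zero u hu := by
    have := congrArg (algebraMap (𝓞 M) M) hu
    obtain ⟨h1, h2, h3⟩ := eq_zero_of_quadratic_eq_zero (a := u.1) (b := u.2.1) (c := u.2.2) hμ
      (by simpa [cubicElt] using this)
    exact Prod.ext h1 (Prod.ext h2 h3)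

/-- The three embeddings into `ℝ`, ordered by the image of `θ`. -/
structure IsOrderedRealEmbeddings {R : Type*} [CommRing R] (θ : R) (σ : Fin 3 → R →+* ℝ) :
    Prop where
  injective : ∀ i, Function.Injective (σ i)
  mem_Ioo_zero : σ 0 θ ∈ Set.Ioo (0 : ℝ) 1
  mem_Ioo_one : σ 1 θ ∈ Set.Ioo (1 : ℝ) 2
  mem_Ioo_two : σ 2 θ ∈ Set.Ioo (5 : ℝ) 6

theorem exists_isOrderedRealEmbeddings {M : Type*} [Field M] [NumberField M] {θ : 𝓞 M}
    (hμ : (θ : M) ^ 3 - 8 * (θ : M) ^ 2 + 15 * (θ : M) - 7 = 0)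
    (hM : Algebra.adjoin ℚ {(θ : M)} = ⊤) : ∃ σ, IsOrderedRealEmbeddings θ σ := by
  have hext (r : ℝ) (hr : r ^ 3 - 8 * r ^ 2 + 15 * r - 7 = 0) :
      ∃ τ : 𝓞 M →+* ℝ, Function.Injective τ ∧ τ θ = r := by
    let pb := PowerBasis.ofAdjoinEqTop (Algebra.IsIntegral.isIntegral ((θ : M) - 9))
      (adjoin_sub_nine_eq_top hM)
    have hgen : pb.gen = (θ : M) - 9 := by simp [pb]
    let τ : M →ₐ[ℚ] ℝ := pb.lift (r - 9) (by
      rw [hgen, minpoly_sub_nine hμ]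
      simp only [map_add, map_mul, map_pow, aeval_X, map_ofNat]
      linear_combination hr)
    refine ⟨(τ : M →+* ℝ).comp (algebraMap (𝓞 M) M), ?_, ?_⟩
    · exact (τ : M →+* ℝ).injective.comp RingOfIntegers.coe_injective
    · have h1 : τ ((θ : M) - 9) = r - 9 := by
        rw [← hgen]
        exact pb.lift_gen _ _
      rw [map_sub, map_ofNat] at h1
      change τ (θ : M) = r
      linarith
  have hcont : Continuous fun x : ℝ => x ^ 3 - 8 * x ^ 2 + 15 * x - 7 := by fun_prop
  obtain ⟨r0, hr0, h0⟩ := intermediate_value_Ioo (zero_le_one' ℝ) hcont.continuousOn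
    (show (0 : ℝ) ∈ _ by constructor <;> norm_num)
  obtain ⟨r1, hr1, h1⟩ := intermediate_value_Ioo' (one_le_two (α := ℝ)) hcont.continuousOn
    (show (0 : ℝ) ∈ _ by constructor <;> norm_num)
  obtain ⟨r2, hr2, h2⟩ := intermediate_value_Ioo (show (5 : ℝ) ≤ 6 by norm_num) hcont.continuousOn
    (show (0 : ℝ) ∈ _ by constructor <;> norm_num)
  obtain ⟨τ0, hτ0, e0⟩ := hext r0 h0
  obtain ⟨τ1, hτ1, e1⟩ := hext r1 h1
  obtain ⟨τ2, hτ2, e2⟩ := hext r2 h2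
  refine ⟨![τ0, τ1, τ2], ?_, ?_, ?_, ?_⟩
  · intro i
    fin_cases i <;> simpa
  · simpa [e0] using hr0
  · simpa [e1] using hr1
  · simpa [e2] using hr2

namespace IsOrderedRealEmbeddings

variable {R : Type*} [CommRing R] {θ : R} {σ : Fin 3 → R →+* ℝ}

theorem exists_prod_eq_intCast (hσ : IsOrderedRealEmbeddings θ σ) (h : IsCubicBasis θ) (z : R) :
    ∃ n : ℤ, σ 0 z * σ 1 z * σ 2 z = n := by
  obtain ⟨⟨a, b, c⟩, rfl⟩ := h.exists_eq z
  have hroot (i : Fin 3) : σ i θ ^ 3 - 8 * σ i θ ^ 2 + 15 * σ i θ - 7 = 0 := by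
    have := congrArg (σ i) h.cubic
    simpa only [map_sub, map_add, map_mul, map_pow, map_ofNat, map_zero] using this
  simp only [cubicElt, map_add, map_mul, map_pow, map_intCast]
  have p0 := hroot 0
  have p1 := hroot 1
  have p2 := hroot 2
  obtain ⟨l0, u0⟩ := hσ.mem_Ioo_zero
  obtain ⟨l1, u1⟩ := hσ.mem_Ioo_one
  obtain ⟨l2, u2⟩ := hσ.mem_Ioo_two
  generalize σ 0 θ = r at *
  generalize σ 1 θ = s at *
  generalize σ 2 θ = t at *
  have q1 : r ^ 2 + r * s + s ^ 2 - 8 * (r + s) + 15 = 0 := by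
    apply mul_left_cancel₀ (show r - s ≠ 0 by linarith)
    linear_combination p0 - p1
  have q2 : s ^ 2 + s * t + t ^ 2 - 8 * (s + t) + 15 = 0 := by
    apply mul_left_cancel₀ (show s - t ≠ 0 by linarith)
    linear_combination p1 - p2
  have e1 : r + s + t = 8 := by
    apply mul_left_cancel₀ (show r - t ≠ 0 by linarith)
    linear_combination q1 - q2
  have e2 : r * s + r * t + s * t = 15 := by
    linear_combination (r + s) * e1 - q1
  have e3 : r * s * t = 7 := by
    linear_combination p0 + r * e2 - r ^ 2 * e1
  refine ⟨a ^ 3 + 8 * a ^ 2 * b + 34 * a ^ 2 * c + 15 * a * b ^ 2 + 99 * a * b * c + 113 * a * c ^ 2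
    + 7 * b ^ 3 + 56 * b ^ 2 * c + 105 * b * c ^ 2 + 49 * c ^ 3, ?_⟩
  have key : ∀ A B D : ℝ, (A + B * r + D * r ^ 2) * (A + B * s + D * s ^ 2) * (A + B * t + D * t ^ 2) =
      A ^ 3 + (r + s + t) * A ^ 2 * B + ((r + s + t) ^ 2 - 2 * (r * s + r * t + s * t)) * A ^ 2 * D
      + (r * s + r * t + s * t) * A * B ^ 2
      + ((r + s + t) * (r * s + r * t + s * t) - 3 * (r * s * t)) * A * B * D
      + ((r * s + r * t + s * t) ^ 2 - 2 * (r + s + t) * (r * s * t)) * A * D ^ 2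
      + (r * s * t) * B ^ 3 + (r * s * t) * (r + s + t) * B ^ 2 * D
      + (r * s * t) * (r * s + r * t + s * t) * B * D ^ 2 + (r * s * t) ^ 2 * D ^ 3 := by
    intro A B D
    ring
  rw [key, e1, e2, e3]
  push_cast
  ring

theorem eq_one_of_mem_Icc (hσ : IsOrderedRealEmbeddings θ σ) (h : IsCubicBasis θ) {z : R}
    (hz : z ≠ 0) (h0 : ∀ i, 0 ≤ σ i z) (h1 : ∀ i, σ i z ≤ 1) : z = 1 := by
  have hpos (i : Fin 3) : 0 < σ i z :=
    lt_of_le_of_ne (h0 i) fun e => hz (hσ.injective i (by rw [← e, map_zero]))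
  obtain ⟨n, hn⟩ := hσ.exists_prod_eq_intCast h z
  have hn1 : 1 ≤ n := by
    have : (0 : ℝ) < n := hn ▸ mul_pos (mul_pos (hpos 0) (hpos 1)) (hpos 2)
    exact_mod_cast this
  have hn2 : (1 : ℝ) ≤ σ 0 z * σ 1 z * σ 2 z := by rw [hn]; exact_mod_cast hn1
  apply hσ.injective 0
  rw [map_one]
  have h01 : σ 0 z * σ 1 z ≤ σ 0 z := mul_le_of_le_one_right (h0 0) (h1 1)
  have h012 : σ 0 z * σ 1 z * σ 2 z ≤ σ 0 z * σ 1 z :=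
    mul_le_of_le_one_right (mul_nonneg (h0 0) (h0 1)) (h1 2)
  linarith [h1 0]

end IsOrderedRealEmbeddings

theorem exists_unit_of_signs {R : Type*} [CommRing R] {θ : R} {σ : Fin 3 → R →+* ℝ}
    (h : IsCubicBasis θ) (hσ : IsOrderedRealEmbeddings θ σ)
    (t : Fin 3 → Bool) : ∃ (v : Rˣ) (u : ℤ × ℤ × ℤ), (v : R) = cubicElt θ u ∧
      (∀ i, decide (0 < σ i v) = t i) ∧
      ((∃ i, t i = false) → ∀ a b c : ZMod 4,
        cubicMul ((u.1 : ZMod 4), (u.2.1 : ZMod 4), (u.2.2 : ZMod 4))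
          (cubicMul (a, b, c) (a, b, c)) ≠ (1, 0, 0)) := by
  obtain ⟨l0, u0⟩ := hσ.mem_Ioo_zero
  obtain ⟨l1, u1⟩ := hσ.mem_Ioo_one
  obtain ⟨l2, u2⟩ := hσ.mem_Ioo_two
  let e1 : Rˣ := Units.mkOfMulEqOne (θ - 1) (-(θ ^ 2 - 7 * θ + 8))
    (by linear_combination -h.cubic)
  let e2 : Rˣ := Units.mkOfMulEqOne (θ - 2) (θ ^ 2 - 6 * θ + 3)
    (by linear_combination h.cubic)
  have he1 : (e1 : R) = θ - 1 := rfl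
  have he2 : (e2 : R) = θ - 2 := rfl
  have hs1 : σ 0 θ - 1 < 0 ∧ 0 < σ 1 θ - 1 ∧ 0 < σ 2 θ - 1 := by
    refine ⟨?_, ?_, ?_⟩ <;> linarith
  have hs2 : σ 0 θ - 2 < 0 ∧ σ 1 θ - 2 < 0 ∧ 0 < σ 2 θ - 2 := by
    refine ⟨?_, ?_, ?_⟩ <;> linarith
  have hs3 : 0 < (σ 0 θ - 1) * (σ 0 θ - 2) ∧ (σ 1 θ - 1) * (σ 1 θ - 2) < 0 ∧
      0 < (σ 2 θ - 1) * (σ 2 θ - 2) :=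
    ⟨mul_pos_of_neg_of_neg hs1.1 hs2.1, mul_neg_of_pos_of_neg hs1.2.1 hs2.2.1,
      mul_pos hs1.2.2 hs2.2.2⟩
  have key (v : Rˣ) (u : ℤ × ℤ × ℤ) (hvu : (v : R) = cubicElt θ u)
      (hs : ∀ i, decide (0 < σ i v) = t i)
      (hu : ∀ a b c : ZMod 4,
        cubicMul ((u.1 : ZMod 4), (u.2.1 : ZMod 4), (u.2.2 : ZMod 4))
          (cubicMul (a, b, c) (a, b, c)) ≠ (1, 0, 0)) :=
    (⟨v, u, hvu, hs, fun _ => hu⟩ : ∃ (v : Rˣ) (u : ℤ × ℤ × ℤ), (v : R) = cubicElt θ u ∧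
      (∀ i, decide (0 < σ i v) = t i) ∧
      ((∃ i, t i = false) → ∀ a b c : ZMod 4,
        cubicMul ((u.1 : ZMod 4), (u.2.1 : ZMod 4), (u.2.2 : ZMod 4))
          (cubicMul (a, b, c) (a, b, c)) ≠ (1, 0, 0)))
  have hσ2 (i : Fin 3) : σ i 2 = 2 := map_ofNat (σ i) 2
  cases h0 : t 0 <;> cases h1 : t 1 <;> cases h2 : t 2
  · refine key (-1) (-1, 0, 0) (by simp [cubicElt]) ?_ (by decide)
    simp [Fin.forall_fin_succ, h0, h1, h2]
  · refine key e2 (-2, 1, 0) (by simp [cubicElt, he2]; ring) ?_ (by decide)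
    simp [Fin.forall_fin_succ, he2, hσ2, h0, h1, h2]
    grind
  · refine key (-(e1 * e2)) (-2, 3, -1) (by simp [cubicElt, he1, he2]; ring) ?_ (by decide)
    simp [Fin.forall_fin_succ, he1, he2, hσ2, h0, h1, h2]
    grind
  · refine key e1 (-1, 1, 0) (by simp [cubicElt, he1]; ring) ?_ (by decide)
    simp [Fin.forall_fin_succ, he1, h0, h1, h2]
    grind
  · refine key (-e1) (1, -1, 0) (by simp [cubicElt, he1]; ring) ?_ (by decide)
    simp [Fin.forall_fin_succ, he1, h0, h1, h2]
    grind
  · refine key (e1 * e2) (2, -3, 1) (by simp [cubicElt, he1, he2]; ring) ?_ (by decide)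
    simp [Fin.forall_fin_succ, he1, he2, hσ2, h0, h1, h2]
    grind
  · refine key (-e2) (2, -1, 0) (by simp [cubicElt, he2]; ring) ?_ (by decide)
    simp [Fin.forall_fin_succ, he2, hσ2, h0, h1, h2]
    grind
  · refine ⟨1, (1, 0, 0), by simp [cubicElt], ?_, ?_⟩
    · simp [Fin.forall_fin_succ, h0, h1, h2]
    · rintro ⟨i, hi⟩
      fin_cases i <;> simp_all

section Units

variable {M : Type*} [Field M] [NumberField M]

theorem units_rank_le_two_of_finrank_eq_three (hfin : Module.finrank ℚ M = 3) :
    Units.rank M ≤ 2 := by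
  have h1 := InfinitePlace.card_add_two_mul_card_eq_rank M
  have h2 := InfinitePlace.card_eq_nrRealPlaces_add_nrComplexPlaces M
  rw [Units.rank, h2]
  omega

theorem exists_eq_prod_bool_mul_sq (hfin : Odd (Module.finrank ℚ M)) (v : (𝓞 M)ˣ) :
    ∃ (p : Bool × (Fin (Units.rank M) → Bool)) (η : (𝓞 M)ˣ),
      v = (bif p.1 then 1 else -1) * (∏ i, bif p.2 i then Units.fundSystem M i else 1) * η ^ 2 := by
  obtain ⟨⟨ζ, k⟩, hv, -⟩ := Units.exist_unique_eq_mul_prod M v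
  have hprod : ∏ i, Units.fundSystem M i ^ k i =
      (∏ i, bif decide (Odd (k i)) then Units.fundSystem M i else 1) *
        (∏ i, Units.fundSystem M i ^ (k i / 2)) ^ 2 := by
    rw [← Finset.prod_pow, ← Finset.prod_mul_distrib]
    refine Finset.prod_congr rfl fun i _ => ?_
    rw [← zpow_natCast, ← zpow_mul]
    rcases Int.even_or_odd (k i) with hk | hk
    · rw [show decide (Odd (k i)) = false by simpa using hk, cond_false, one_mul]
      congr 1
      obtain ⟨m, hm⟩ := hk
      push_cast
      omega
    · rw [show decide (Odd (k i)) = true by simpa using hk, cond_true, ← zpow_one_add]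
      congr 1
      obtain ⟨m, hm⟩ := hk
      push_cast
      omega
  simp only at hv
  rcases Units.torsion_eq_one_or_neg_one_of_odd_finrank hfin ζ with h | h
  · refine ⟨(true, fun i => decide (Odd (k i))), ∏ i, Units.fundSystem M i ^ (k i / 2), ?_⟩
    rw [hv, h, hprod, mul_assoc]
    rfl
  · refine ⟨(false, fun i => decide (Odd (k i))), ∏ i, Units.fundSystem M i ^ (k i / 2), ?_⟩
    rw [hv, h, hprod, mul_assoc]
    rfl

theorem unit_eq_mul_sq_of_sign_eq (hfin : Module.finrank ℚ M = 3) {σ : Fin 3 → 𝓞 M →+* ℝ}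
    (hsurj : ∀ t : Fin 3 → Bool, ∃ v : (𝓞 M)ˣ, ∀ i, decide (0 < σ i v) = t i)
    {v w : (𝓞 M)ˣ} (hvw : ∀ i, 0 < σ i v ↔ 0 < σ i w) : ∃ η : (𝓞 M)ˣ, v = w * η ^ 2 := by
  classical
  let sg (u : (𝓞 M)ˣ) : Fin 3 → Bool := fun i => decide (0 < σ i u)
  have hsg (u η : (𝓞 M)ˣ) : sg (u * η ^ 2) = sg u := by
    ext1 i
    have hne : σ i η ≠ 0 := (η.isUnit.map (σ i)).ne_zero
    have hpos : 0 < σ i η ^ 2 := by positivity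
    simp only [sg, Units.val_mul, Units.val_pow_eq_pow_val, map_mul, map_pow,
      mul_pos_iff_of_pos_right hpos]
  let G (p : Bool × (Fin (Units.rank M) → Bool)) : (𝓞 M)ˣ :=
    (bif p.1 then 1 else -1) * (∏ i, bif p.2 i then Units.fundSystem M i else 1)
  have hG (u : (𝓞 M)ˣ) : ∃ p η, u = G p * η ^ 2 :=
    exists_eq_prod_bool_mul_sq (by rw [hfin]; decide) u
  have hsurjG : Function.Surjective (sg ∘ G) := by
    intro t
    obtain ⟨u, hu⟩ := hsurj t
    obtain ⟨p, η, rfl⟩ := hG u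
    refine ⟨p, ?_⟩
    rw [Function.comp, ← hsg _ η]
    exact funext hu
  have hbij : Function.Bijective (sg ∘ G) := by
    apply hsurjG.bijective_of_nat_card_le
    have := units_rank_le_two_of_finrank_eq_three hfin
    have : 2 ^ Units.rank M ≤ 2 ^ 2 := Nat.pow_le_pow_right (by norm_num) this
    simp only [Nat.card_eq_fintype_card, Fintype.card_prod, Fintype.card_bool, Fintype.card_fun,
      Fintype.card_fin]
    omega
  obtain ⟨p, η, rfl⟩ := hG v
  obtain ⟨q, κ, rfl⟩ := hG w
  have hpq : p = q := by
    apply hbij.1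
    rw [Function.comp, Function.comp, ← hsg _ η, ← hsg (G q) κ]
    exact funext fun i => decide_eq_decide.2 (hvw i)
  refine ⟨η * κ⁻¹, ?_⟩
  rw [hpq, mul_assoc (G q), ← mul_pow, mul_left_comm, mul_inv_cancel, mul_one]

variable {θ : 𝓞 M} {σ : Fin 3 → 𝓞 M →+* ℝ}

theorem exists_sq_of_totally_positive (hfin : Module.finrank ℚ M = 3) (h : IsCubicBasis θ)
    (hσ : IsOrderedRealEmbeddings θ σ) {v : (𝓞 M)ˣ} (hv : ∀ i, 0 < σ i v) :
    ∃ η : (𝓞 M)ˣ, v = η ^ 2 := by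
  obtain ⟨η, hη⟩ := unit_eq_mul_sq_of_sign_eq hfin (v := v) (w := 1)
    (fun t => let ⟨v, _, _, hs, _⟩ := exists_unit_of_signs h hσ t; ⟨v, hs⟩) (by simpa using hv)
  exact ⟨η, by rw [hη, one_mul]⟩

theorem totally_positive_of_four_dvd (hfin : Module.finrank ℚ M = 3) (h : IsCubicBasis θ)
    (hσ : IsOrderedRealEmbeddings θ σ) {v : (𝓞 M)ˣ} (hv : (4 : 𝓞 M) ∣ v - 1) (i : Fin 3) :
    0 < σ i v := by
  obtain ⟨w, u, hwu, hs, hu⟩ := exists_unit_of_signs h hσ fun i => decide (0 < σ i v)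
  obtain ⟨η, rfl⟩ := unit_eq_mul_sq_of_sign_eq hfin (v := v) (w := w)
    (fun t => let ⟨v, _, _, hs, _⟩ := exists_unit_of_signs h hσ t; ⟨v, hs⟩)
    (fun i => (decide_eq_decide.1 (hs i)).symm)
  by_contra hneg
  refine h.not_four_dvd_mul_sq_sub_one u η (hu ⟨i, by simpa using hneg⟩) ?_
  simpa [hwu] using hv

end Units

section Quartic

variable {M K : Type*} [Field M] [NumberField M] [Field K] [Algebra M K]
  {θ : 𝓞 M} {ξ : K}

theorem isEisensteinAt_of_dvd {R : Type*} [CommRing R] [Nontrivial R] {p a b c d : R}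
    (hp : Prime p) (ha : p ∣ a) (hb : p ∣ b) (hc : p ∣ c) (hd : p ∣ d) (hd' : ¬ p ^ 2 ∣ d) :
    (X ^ 4 + C a * X ^ 3 + C b * X ^ 2 + C c * X + C d).Monic ∧
    (X ^ 4 + C a * X ^ 3 + C b * X ^ 2 + C c * X + C d).natDegree = 4 ∧
    (X ^ 4 + C a * X ^ 3 + C b * X ^ 2 + C c * X + C d).IsEisensteinAt (Ideal.span {p}) := by
  have hm : (X ^ 4 + C a * X ^ 3 + C b * X ^ 2 + C c * X + C d).Monic := by monicity!
  have hdeg : (X ^ 4 + C a * X ^ 3 + C b * X ^ 2 + C c * X + C d).natDegree = 4 := by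
    compute_degree!
  refine ⟨hm, hdeg, hm.isEisensteinAt_of_mem_of_notMem ?_ ?_ ?_⟩
  · rw [Ne, Ideal.span_singleton_eq_top]
    exact hp.not_isUnit
  · intro n hn
    rw [hdeg] at hn
    rw [Ideal.mem_span_singleton]
    interval_cases n <;> simpa [coeff_X, coeff_X_pow, coeff_C]
  · rw [Ideal.span_singleton_pow, Ideal.mem_span_singleton]
    simpa [coeff_X, coeff_X_pow]

theorem isEisensteinAt_quartic {R : Type*} [CommRing R] [IsDomain R] {θ : R} (h : Prime θ) :
    (X ^ 4 + C θ).Monic ∧ (X ^ 4 + C θ).natDegree = 4 ∧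
      (X ^ 4 + C θ).IsEisensteinAt (Ideal.span {θ}) := by
  have hsq : ¬ θ ^ 2 ∣ θ := by
    simpa using (pow_dvd_pow_iff (n := 2) (m := 1) h.ne_zero h.not_isUnit).not.2 (by norm_num)
  simpa using isEisensteinAt_of_dvd h (dvd_zero θ) (dvd_zero θ) (dvd_zero θ) dvd_rfl hsq

theorem isEisensteinAt_shifted_quartic {R : Type*} [CommRing R] {θ : R} (h : IsCubicBasis θ) :
    ((X + C (θ ^ 2)) ^ 4 + C θ).Monic ∧ ((X + C (θ ^ 2)) ^ 4 + C θ).natDegree = 4 ∧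
      ((X + C (θ ^ 2)) ^ 4 + C θ).IsEisensteinAt (Ideal.span {2}) := by
  have := h.nontrivial
  have h0 : (X + C (θ ^ 2)) ^ 4 + C θ = X ^ 4 + C (4 * θ ^ 2) * X ^ 3 + C (6 * θ ^ 4) * X ^ 2 +
      C (4 * θ ^ 6) * X + C (θ ^ 8 + θ) := by
    simp only [map_add, map_mul, map_pow, map_ofNat]
    ring
  have hc : θ ^ 8 + θ = cubicElt θ (60074, -117858, 47314) := by
    simp only [cubicElt]
    push_cast
    linear_combination (θ ^ 5 + 8 * θ ^ 4 + 49 * θ ^ 3 + 279 * θ ^ 2 + 1553 * θ + 8582) * h.cubic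
  have h4 : (2 : R) ∣ 4 := ⟨2, by norm_num⟩
  have h6 : (2 : R) ∣ 6 := ⟨3, by norm_num⟩
  have hdvd2 := h.intCast_dvd_iff 2 (60074, -117858, 47314)
  have hdvd4 := h.intCast_dvd_iff 4 (60074, -117858, 47314)
  norm_num at hdvd2 hdvd4
  rw [h0]
  refine isEisensteinAt_of_dvd h.two_prime (h4.mul_right _) (h6.mul_right _) (h4.mul_right _) ?_ ?_
  · rwa [hc]
  · norm_num [hc, hdvd4]

theorem minpoly_eq_quartic (h : IsCubicBasis θ) (hξ : ξ ^ 4 = -algebraMap (𝓞 M) K θ) :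
    minpoly M ξ = X ^ 4 + C (θ : M) := by
  obtain ⟨hm, hd, hE⟩ := isEisensteinAt_quartic h.self_prime
  rw [(minpoly_eq_of_isEisensteinAt (F := M) h.self_prime hm (by omega) hE (by simp [hξ])).2]
  simp

theorem natDegree_minpoly_eq_four (h : IsCubicBasis θ) (hξ : ξ ^ 4 = -algebraMap (𝓞 M) K θ) :
    (minpoly M ξ).natDegree = 4 := by
  rw [minpoly_eq_quartic h hξ]
  compute_degree!

variable [NumberField K]

theorem finrank_eq_four (h : IsCubicBasis θ) (hξ : ξ ^ 4 = -algebraMap (𝓞 M) K θ)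
    (htop : Algebra.adjoin M {ξ} = ⊤) : Module.finrank M K = 4 := by
  rw [(PowerBasis.ofAdjoinEqTop (Algebra.IsIntegral.isIntegral ξ) htop).finrank,
    ← PowerBasis.natDegree_minpoly]
  simpa using natDegree_minpoly_eq_four h hξ

theorem norm_eq_theta (h : IsCubicBasis θ) (hξ : ξ ^ 4 = -algebraMap (𝓞 M) K θ)
    (htop : Algebra.adjoin M {ξ} = ⊤) : Algebra.norm M ξ = θ := by
  have := Algebra.PowerBasis.norm_gen_eq_coeff_zero_minpoly
    (PowerBasis.ofAdjoinEqTop (Algebra.IsIntegral.isIntegral (R := M) ξ) htop)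
  rw [← PowerBasis.natDegree_minpoly, PowerBasis.ofAdjoinEqTop_gen, natDegree_minpoly_eq_four h hξ,
    minpoly_eq_quartic h hξ] at this
  norm_num [coeff_X_pow] at this
  exact this

theorem adjoin_sub_algebraMap_eq {R A : Type*} [CommRing R] [CommRing A] [Algebra R A] (x : A)
    (c : R) : Algebra.adjoin R {x - algebraMap R A c} = Algebra.adjoin R {x} := by
  apply le_antisymm <;> rw [Algebra.adjoin_le_iff, Set.singleton_subset_iff]
  · exact sub_mem (Algebra.self_mem_adjoin_singleton R x) (Subalgebra.algebraMap_mem _ c)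
  · simpa using add_mem (Algebra.self_mem_adjoin_singleton R (x - algebraMap R A c))
      (Subalgebra.algebraMap_mem _ c)

theorem mem_adjoin_of_isIntegral (h : IsCubicBasis θ) (hξ : ξ ^ 4 = -algebraMap (𝓞 M) K θ)
    (htop : Algebra.adjoin M {ξ} = ⊤) {z : K} (hz : IsIntegral (𝓞 M) z) :
    z ∈ Algebra.adjoin (𝓞 M) {ξ} := by
  obtain ⟨hm, hd, hE⟩ := isEisensteinAt_quartic h.self_prime
  obtain ⟨hm', hd', hE'⟩ := isEisensteinAt_shifted_quartic h
  have hint : IsIntegral (𝓞 M) ξ := ⟨X ^ 4 + C θ, hm, by simp [hξ]⟩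
  have h1 := derivative_norm_smul_mem_adjoin hint htop hz
  have h2 : Algebra.norm M (aeval ξ (derivative (minpoly M ξ))) =
      ((2 ^ 8 * θ ^ 3 : 𝓞 M) : M) := by
    have h5 : aeval ξ (derivative (X ^ 4 + C (θ : M))) = algebraMap M K 4 * ξ ^ 3 := by
      simp only [derivative_add, derivative_X_pow, derivative_C, add_zero, map_mul, map_pow, aeval_X,
        aeval_C]
      norm_num
    rw [minpoly_eq_quartic h hξ, h5, map_mul, map_pow, norm_eq_theta h hξ htop,
      Algebra.norm_algebraMap, finrank_eq_four h hξ htop]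
    simp only [map_mul, map_pow, map_ofNat]
    norm_num
  have hadj := adjoin_sub_algebraMap_eq ξ (θ ^ 2)
  rw [h2, algebraMap_smul, mul_smul, ← hadj] at h1
  have htop' : Algebra.adjoin M {ξ - algebraMap (𝓞 M) K (θ ^ 2)} = ⊤ :=
    adjoin_sub_eq_top htop (by
      rw [IsScalarTower.algebraMap_apply (𝓞 M) M K]
      exact Subalgebra.algebraMap_mem _ _)
  have h3 := mem_adjoin_of_isEisensteinAt h.two_prime hm' (by omega) hE' (by simp [hξ]) htop'
    (hz.smul (θ ^ 3)) h1
  rw [hadj] at h3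
  exact mem_adjoin_of_isEisensteinAt h.self_prime hm (by omega) hE (by simp [hξ]) htop hz h3

theorem exists_cubic_of_isIntegral (h : IsCubicBasis θ) (hξ : ξ ^ 4 = -algebraMap (𝓞 M) K θ)
    (htop : Algebra.adjoin M {ξ} = ⊤) {z : K} (hz : IsIntegral (𝓞 M) z) :
    ∃ c : Fin 4 → 𝓞 M, z = ∑ i, algebraMap (𝓞 M) K (c i) * ξ ^ (i : ℕ) := by
  obtain ⟨hm, hd, hE⟩ := isEisensteinAt_quartic h.self_prime
  obtain ⟨c, hc⟩ := exists_sum_range_of_mem_adjoin hm (by omega) hd.le (by simp [hξ])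
    (mem_adjoin_of_isIntegral h hξ htop hz)
  refine ⟨fun i => c i, ?_⟩
  rw [hc, Finset.sum_range]
  simp [Algebra.smul_def]

theorem eq_of_cubic_eq (h : IsCubicBasis θ) (hξ : ξ ^ 4 = -algebraMap (𝓞 M) K θ)
    {c d : Fin 4 → 𝓞 M} (hcd : ∑ i, algebraMap (𝓞 M) K (c i) * ξ ^ (i : ℕ) =
      ∑ i, algebraMap (𝓞 M) K (d i) * ξ ^ (i : ℕ)) : c = d := by
  have hd := natDegree_minpoly_eq_four h hξ
  have h1 := eq_zero_of_aeval_eq_zero_of_natDegree_lt (F := M) (x := ξ)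
    (q := ∑ i : Fin 4, C ((c i - d i : 𝓞 M) : M) * X ^ (i : ℕ)) (by
      simp only [map_sum, map_mul, aeval_C, map_pow, aeval_X]
      simp only [← IsScalarTower.algebraMap_apply, map_sub, sub_mul, Finset.sum_sub_distrib, hcd,
        sub_self]) (by
      rw [hd, Nat.lt_succ_iff]
      refine natDegree_sum_le_of_forall_le _ _ fun i _ => ?_
      exact (natDegree_C_mul_X_pow_le _ _).trans (by omega))
  ext1 j
  have h2 := congrArg (fun q => coeff q j) h1
  simp only [finsetSum_coeff, coeff_C_mul, coeff_X_pow, coeff_zero] at h2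
  rw [Finset.sum_eq_single j (by
    intro b _ hb
    simp [Fin.val_inj, hb.symm]) (by simp)] at h2
  simpa [sub_eq_zero] using h2

end Quartic

/-- Coordinates of `1, β, β², β³` with respect to `1, ξ, ξ², ξ³`, where `ξ⁴ = -θ` and
`β = x ξ + y ξ² + z ξ³`. -/
def powerMatrix {R : Type*} [CommRing R] (θ x y z : R) : Matrix (Fin 4) (Fin 4) R :=
  !![1, 0, 0, 0;
    0, x, y, z;
    -θ * (y ^ 2 + 2 * x * z), -2 * θ * y * z, x ^ 2 - θ * z ^ 2, 2 * x * y;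
    θ * (3 * θ * y * z ^ 2 - 3 * x ^ 2 * y), θ * (θ * z ^ 3 - 3 * x * y ^ 2 - 3 * x ^ 2 * z),
      -θ * (y ^ 3 + 6 * x * y * z), x ^ 3 - 3 * θ * x * z ^ 2 - 3 * θ * y ^ 2 * z]

theorem det_powerMatrix {R : Type*} [CommRing R] (θ x y z : R) :
    (powerMatrix θ x y z).det = (x ^ 2 + θ * z ^ 2) *
      ((x ^ 2 - θ * z ^ 2) ^ 2 + 8 * θ * x * z * y ^ 2 - 4 * θ * y ^ 4) := by
  simp [powerMatrix, Matrix.det_succ_row_zero, Fin.sum_univ_succ, Fin.succAbove]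
  ring

theorem pow_eq_sum_powerMatrix {R A : Type*} [CommRing R] [CommRing A] [Algebra R A] {θ : R}
    {ξ β : A} (hξ : ξ ^ 4 = -algebraMap R A θ) {x y z : R}
    (hβ : β = algebraMap R A x * ξ + algebraMap R A y * ξ ^ 2 + algebraMap R A z * ξ ^ 3)
    (i : Fin 4) :
    β ^ (i : ℕ) = ∑ j, algebraMap R A (powerMatrix θ x y z i j) * ξ ^ (j : ℕ) := by
  subst hβ
  generalize hx : algebraMap R A x = x'
  generalize hy : algebraMap R A y = y'
  generalize hz : algebraMap R A z = z'
  have hθ : algebraMap R A θ = -ξ ^ 4 := by rw [hξ, neg_neg]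
  fin_cases i <;> simp [powerMatrix, Fin.sum_univ_succ, hx, hy, hz, hθ, map_ofNat] <;> ring

section Generator

variable {M K : Type*} [Field M] [NumberField M] [Field K] [NumberField K] [Algebra M K]
  {θ : 𝓞 M} {ξ : K}

theorem isUnit_det_powerMatrix (h : IsCubicBasis θ) (hξ : ξ ^ 4 = -algebraMap (𝓞 M) K θ)
    (htop : Algebra.adjoin M {ξ} = ⊤) {β : K} {x y z : 𝓞 M}
    (hβ : β = algebraMap (𝓞 M) K x * ξ + algebraMap (𝓞 M) K y * ξ ^ 2 +
      algebraMap (𝓞 M) K z * ξ ^ 3) (hint : IsIntegral (𝓞 M) β)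
    (hgen : ξ ∈ Algebra.adjoin (𝓞 M) {β}) : IsUnit (powerMatrix θ x y z).det := by
  have hdeg : (minpoly (𝓞 M) β).natDegree ≤ 4 := by
    rw [← finrank_eq_four h hξ htop, ← (minpoly.monic hint).natDegree_map (algebraMap (𝓞 M) M),
      ← minpoly.isIntegrallyClosed_eq_field_fractions' M hint]
    exact minpoly.natDegree_le β
  have hex (i : Fin 4) := exists_sum_range_of_mem_adjoin (minpoly.monic hint)
    (minpoly.natDegree_pos hint) hdeg (minpoly.aeval _ _) (pow_mem hgen (i : ℕ))
  choose B hB using hex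
  have hmul : (Matrix.of fun i (j : Fin 4) => B i j) * powerMatrix θ x y z = 1 := by
    refine Matrix.ext fun i k => ?_
    refine congrFun (eq_of_cubic_eq h hξ (c := fun k => ((Matrix.of fun i (j : Fin 4) => B i j) *
      powerMatrix θ x y z) i k) (d := fun k => (1 : Matrix (Fin 4) (Fin 4) (𝓞 M)) i k) ?_) k
    trans ξ ^ (i : ℕ)
    · rw [hB i, Finset.sum_range]
      simp only [pow_eq_sum_powerMatrix hξ hβ, Algebra.smul_def, Matrix.mul_apply, Matrix.of_apply,
        map_sum, map_mul, Finset.sum_mul, Finset.mul_sum, mul_assoc]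
      rw [Finset.sum_comm]
    · simp [Matrix.one_apply]
  have := congrArg Matrix.det hmul
  rw [Matrix.det_mul, Matrix.det_one] at this
  exact IsUnit.of_mul_eq_one_right _ this

end Generator

section Positivity

variable {M : Type*} [Field M] [NumberField M] {θ : 𝓞 M} {σ : Fin 3 → 𝓞 M →+* ℝ}

theorem IsOrderedRealEmbeddings.pos {R : Type*} [CommRing R] {θ : R} {σ : Fin 3 → R →+* ℝ}
    (hσ : IsOrderedRealEmbeddings θ σ) (i : Fin 3) : 0 < σ i θ := by
  fin_cases i
  · exact hσ.mem_Ioo_zero.1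
  · exact zero_lt_one.trans hσ.mem_Ioo_one.1
  · exact (by norm_num : (0 : ℝ) < 5).trans hσ.mem_Ioo_two.1

theorem eq_zero_of_isUnit_sq_add (hfin : Module.finrank ℚ M = 3) (h : IsCubicBasis θ)
    (hσ : IsOrderedRealEmbeddings θ σ) {x z : 𝓞 M} (hu : IsUnit (x ^ 2 + θ * z ^ 2)) :
    z = 0 := by
  obtain ⟨v, hv⟩ := hu
  obtain ⟨η, rfl⟩ := exists_sq_of_totally_positive hfin h hσ (v := v) fun i => by
    have h1 := hσ.pos i
    refine lt_of_le_of_ne ?_ (v.isUnit.map (σ i)).ne_zero.symm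
    rw [hv, map_add, map_mul, map_pow, map_pow]
    positivity
  obtain ⟨a, rfl⟩ : ∃ a, x = η * a := ⟨↑η⁻¹ * x, by simp⟩
  obtain ⟨b, rfl⟩ : ∃ b, z = η * b := ⟨↑η⁻¹ * z, by simp⟩
  have hab : a ^ 2 + θ * b ^ 2 = 1 := by
    apply mul_left_cancel₀ (pow_ne_zero 2 η.ne_zero)
    rw [Units.val_pow_eq_pow_val] at hv
    linear_combination -hv
  have ha : a ^ 2 ≠ 0 := by
    intro ha
    rw [ha, zero_add] at hab
    exact h.self_prime.not_isUnit (IsUnit.of_mul_eq_one _ hab)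
  have h1 := hσ.eq_one_of_mem_Icc h ha (fun i => by rw [map_pow]; positivity) fun i => by
    have h1 := hσ.pos i
    have h2 := congrArg (σ i) hab
    rw [map_add, map_mul, map_pow, map_pow, map_one] at h2
    rw [map_pow]
    have : 0 ≤ σ i θ * σ i b ^ 2 := by positivity
    linarith
  rw [h1, add_eq_left] at hab
  simpa [h.self_prime.ne_zero] using hab

theorem eq_zero_of_isUnit_pow_four_sub (hfin : Module.finrank ℚ M = 3) (h : IsCubicBasis θ)
    (hσ : IsOrderedRealEmbeddings θ σ) {y : 𝓞 M} {x : (𝓞 M)ˣ}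
    (hu : IsUnit (x ^ 4 - 4 * θ * y ^ 4 : 𝓞 M)) : y = 0 := by
  obtain ⟨b, rfl⟩ : ∃ b, y = x * b := ⟨↑x⁻¹ * y, by simp⟩
  rw [show (x ^ 4 - 4 * θ * (x * b) ^ 4 : 𝓞 M) = x ^ 4 * (1 - 4 * θ * b ^ 4) by ring] at hu
  obtain ⟨v, hv⟩ := isUnit_of_mul_isUnit_right hu
  have hpos := totally_positive_of_four_dvd hfin h hσ (v := v) ⟨-(θ * b ^ 4), by rw [hv]; ring⟩
  have h1 := hσ.eq_one_of_mem_Icc h v.ne_zero (fun i => (hpos i).le) fun i => by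
    have h1 := hσ.pos i
    rw [hv, map_sub, map_mul, map_mul, map_pow, map_one, map_ofNat]
    have : 0 ≤ 4 * σ i θ * σ i b ^ 4 := by positivity
    linarith
  rw [h1, eq_comm, sub_eq_self] at hv
  have : b = 0 := by simpa [h.self_prime.ne_zero] using hv
  rw [this, mul_zero]

end Positivity

/-- Let `K = ℚ(ξ)` with `ξ` a root of `f₁₂(x) = x¹² + 8x⁸ + 15x⁴ + 7`, `μ = −ξ⁴`, and
`M = ℚ(μ)`.  If `α ∈ 𝓞 K` satisfies `𝓞 M[α] = 𝓞 K` (i.e. `α` generates a relative power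
integral basis of `K` over `M`), then `α = A + ε ξ` with `A ∈ 𝓞 M` and `ε` a unit of `𝓞 M`:
up to equivalence, `ξ` is the only generator of relative power integral bases of `K/M`. -/
theorem generators_of_relative_power_integral_bases_of_f12
    (K M : Type*) [Field K] [NumberField K] [Field M] [NumberField M] [Algebra M K]
    (ξ : K) (hroot : ξ ^ 12 + 8 * ξ ^ 8 + 15 * ξ ^ 4 + 7 = 0)
    (hKgen : Algebra.adjoin ℚ {ξ} = ⊤)
    (μ : M) (hμ : algebraMap M K μ = -ξ ^ 4)
    (hMgen : Algebra.adjoin ℚ {μ} = ⊤)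
    (α : 𝓞 K)
    (hα : Algebra.adjoin (𝓞 M) {α} = ⊤) :
    ∃ (A : 𝓞 M) (ε : (𝓞 M)ˣ),
      algebraMap (𝓞 K) K α =
        algebraMap M K (algebraMap (𝓞 M) M A)
          + algebraMap M K (algebraMap (𝓞 M) M (ε : 𝓞 M)) * ξ := by
  have hcubic : μ ^ 3 - 8 * μ ^ 2 + 15 * μ - 7 = 0 := by
    apply (algebraMap M K).injective
    simp only [map_sub, map_add, map_mul, map_pow, map_ofNat, map_zero, hμ]
    linear_combination -hroot
  have hμint : IsIntegral ℤ μ := by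
    refine ⟨X ^ 3 - 8 * X ^ 2 + 15 * X - 7, by monicity!, ?_⟩
    simpa using hcubic
  obtain ⟨θ, rfl⟩ : ∃ θ : 𝓞 M, (θ : M) = μ := ⟨⟨μ, hμint⟩, rfl⟩
  have hfin := finrank_eq_three hcubic hMgen
  have h := isCubicBasis_ringOfIntegers hcubic hMgen
  obtain ⟨σ, hσ⟩ := exists_isOrderedRealEmbeddings hcubic hMgen
  have hξ : ξ ^ 4 = -algebraMap (𝓞 M) K θ := by
    rw [IsScalarTower.algebraMap_apply (𝓞 M) M K, hμ, neg_neg]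
  have htop : Algebra.adjoin M {ξ} = ⊤ := by
    have := Algebra.adjoin_le (S := (Algebra.adjoin M {ξ}).restrictScalars ℚ)
      (Algebra.subset_adjoin (R := M) (s := {ξ}))
    rw [hKgen] at this
    exact eq_top_iff.2 fun z _ => this (Algebra.mem_top (x := z))
  have : IsScalarTower (𝓞 M) (𝓞 K) K := IsScalarTower.of_algebraMap_eq' rfl
  have hgen (z : 𝓞 K) : (z : K) ∈ Algebra.adjoin (𝓞 M) {(α : K)} := by
    have h1 := (IsScalarTower.toAlgHom (𝓞 M) (𝓞 K) K).map_adjoin {α}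
    rw [hα, Set.image_singleton] at h1
    exact h1 ▸ ⟨z, Algebra.mem_top, rfl⟩
  have hint (z : 𝓞 K) : IsIntegral (𝓞 M) (z : K) := z.isIntegral_coe.tower_top
  obtain ⟨c, hc⟩ := exists_cubic_of_isIntegral h hξ htop (hint α)
  simp only [Fin.sum_univ_four] at hc
  have hξint : IsIntegral ℤ ξ := by
    refine ⟨X ^ 12 + 8 * X ^ 8 + 15 * X ^ 4 + 7, by monicity!, ?_⟩
    simpa using hroot
  have hadj := adjoin_sub_algebraMap_eq (α : K) (c 0)
  have hdet := isUnit_det_powerMatrix h hξ htop (β := α - algebraMap (𝓞 M) K (c 0)) (x := c 1)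
    (y := c 2) (z := c 3) (by rw [hc]; simp; ring) ((hint α).sub isIntegral_algebraMap)
    (hadj ▸ hgen ⟨ξ, hξint⟩)
  rw [det_powerMatrix] at hdet
  have hz := eq_zero_of_isUnit_sq_add hfin h hσ (isUnit_of_mul_isUnit_left hdet)
  rw [hz] at hdet
  obtain ⟨ε, hε⟩ : IsUnit (c 1) := by
    simpa using isUnit_of_mul_isUnit_left hdet
  have hy := eq_zero_of_isUnit_pow_four_sub hfin h hσ (y := c 2) (x := ε) (by
    convert isUnit_of_mul_isUnit_right hdet using 1
    rw [hε]
    ring)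
  refine ⟨c 0, ε, hc.trans ?_⟩
  rw [hε, hy, hz, ← IsScalarTower.algebraMap_apply, ← IsScalarTower.algebraMap_apply]
  simp
end
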